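/- arXiv:2207.02920 — 2 statements merged into one kernel-verified Lean document; each statement's English description precedes it below -/
import Mathlib

section
/- f(n, 4, 5) = (5/6)n + o(n); that is, for every ε > 0 there exists N such that for all n ≥ N one has |f(n, 4, 5) − (5/6)n| ≤ εn. -/
/-- The set of colors spanned by a vertex subset `S` under the edge-coloring `χ`. -/
def spannedColors {n : ℕ} (χ : Fin n → Fin n → ℕ) (S : Finset (Fin n)) : Finset ℕ :=
  ((S ×ˢ S).filter (fun e => e.1 ≠ e.2)).image (fun e => χ e.1 e.2)

/-- `χ` is a `(p, q)`-coloring of `K_n`: it is symmetric (a coloring of unordered pairs)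
and every `p`-element vertex set spans at least `q` distinct colors. -/
def IsPQColoring (n p q : ℕ) (χ : Fin n → Fin n → ℕ) : Prop :=
  (∀ i j, χ i j = χ j i) ∧
  ∀ S : Finset (Fin n), S.card = p → q ≤ (spannedColors χ S).card

/-- The set of colors used by `χ` on the edges of `K_n`. -/
def usedColors {n : ℕ} (χ : Fin n → Fin n → ℕ) : Finset ℕ :=
  ((Finset.univ : Finset (Fin n × Fin n)).filter (fun e => e.1 ≠ e.2)).image
    (fun e => χ e.1 e.2)

/-- The Erdős–Gyárfás function `f(n, p, q)`: the minimum number of colors in a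
`(p, q)`-coloring of `K_n`. -/
noncomputable def erdosGyarfas (n p q : ℕ) : ℕ :=
  sInf {m : ℕ | ∃ χ : Fin n → Fin n → ℕ, IsPQColoring n p q χ ∧ (usedColors χ).card = m}

/-- A coloring of the edges of a complete graph in which a monochromatic two-edge path `x - b - y`
never shares a four-element vertex set with a second color repetition. -/
structure IsWeakColoring {V α : Type*} (c : V → V → α) : Prop where
  symm : ∀ x y, c x y = c y x
  center : ∀ {b x y z}, x ≠ b → y ≠ b → x ≠ y → c b x = c b y →
    z ≠ b → c b z = c b x → z = x ∨ z = y
  leaf : ∀ {b x y z}, x ≠ b → y ≠ b → x ≠ y → c b x = c b y →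
    z ≠ x → c x z = c b x → z = b
  base : ∀ {b x y z}, x ≠ b → y ≠ b → x ≠ y → c b x = c b y →
    z ≠ x → c x z = c x y → z = y
  avoid : ∀ {b x y z}, x ≠ b → y ≠ b → x ≠ y → c b x = c b y →
    z ≠ b → c b z ≠ c x y
  unique : ∀ {b x y z}, x ≠ b → y ≠ b → x ≠ y → c b x = c b y →
    z ≠ x → z ≠ y → c z x = c z y → z = b

/-- There is no four-cycle whose opposite edges have equal colors. -/
def NoAlternatingCycle {V α : Type*} (c : V → V → α) : Prop :=
  ∀ p q r s, p ≠ q → p ≠ r → p ≠ s → q ≠ r → q ≠ s → r ≠ s → c p q = c r s → c q r ≠ c s p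

theorem five_le_card_of_distinct {α : Type*} [DecidableEq α] {S : Finset α} {p q r s t : α}
    (hp : p ∈ S) (hq : q ∈ S) (hr : r ∈ S) (hs : s ∈ S) (ht : t ∈ S)
    (h : [p, q, r, s, t].Nodup) : 5 ≤ S.card := by
  have h1 : [p, q, r, s, t].toFinset.card = 5 := List.toFinset_card_of_nodup h
  rw [← h1]
  apply Finset.card_le_card
  intro x hx
  simp only [List.mem_toFinset, List.mem_cons, List.not_mem_nil, or_false] at hx
  rcases hx with rfl | rfl | rfl | rfl | rfl <;> assumption

namespace IsWeakColoring

variable {V α : Type*} {c : V → V → α}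

theorem five_le_card_of_path [DecidableEq α] (hc : IsWeakColoring c) {S : Finset α} {b x y z : V}
    (hxb : x ≠ b) (hyb : y ≠ b) (hxy : x ≠ y) (hzb : z ≠ b) (hzx : z ≠ x) (hzy : z ≠ y)
    (h : c b x = c b y)
    (hS : ∀ u v, u ∈ [b, x, y, z] → v ∈ [b, x, y, z] → u ≠ v → c u v ∈ S) : 5 ≤ S.card := by
  have h1 := fun {w} => hc.center (z := w) hxb hyb hxy h
  have h2 := fun {w} => hc.leaf (z := w) hxb hyb hxy h
  have h2' := fun {w} => hc.leaf (z := w) hyb hxb hxy.symm h.symm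
  have h3 := fun {w} => hc.base (z := w) hxb hyb hxy h
  have h3' := fun {w} => hc.base (z := w) hyb hxb hxy.symm h.symm
  have h4 := fun {w} => hc.avoid (z := w) hxb hyb hxy h
  have h5 := hc.unique hxb hyb hxy h hzx hzy
  have e1 := hc.symm x y
  have e2 := hc.symm x z
  have e3 := hc.symm y z
  have e4 := hc.symm b z
  have e5 := hc.symm b x
  have e6 := hc.symm b y
  have h6 : c x z ≠ c b z := fun e => hxy
    (hc.base hzb.symm hzx.symm hxb.symm (by rw [← e2, ← e4, e]) hyb (by rw [← h, e5])).symm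
  have h7 : c y z ≠ c b z := fun e => hxy
    (hc.base hzb.symm hzy.symm hyb.symm (by rw [← e3, ← e4, e]) hxb (by rw [h, e6]))
  have m1 : c b x ∈ S := hS _ _ (by simp) (by simp) hxb.symm
  have m2 : c x y ∈ S := hS _ _ (by simp) (by simp) hxy
  have m3 : c x z ∈ S := hS _ _ (by simp) (by simp) hzx.symm
  have m4 : c y z ∈ S := hS _ _ (by simp) (by simp) hzy.symm
  have m5 : c b z ∈ S := hS _ _ (by simp) (by simp) hzb.symm
  refine five_le_card_of_distinct m1 m2 m3 m4 m5 ?_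
  simp only [List.nodup_cons, List.mem_cons, List.not_mem_nil, or_false, not_or,
    List.nodup_nil, not_false_eq_true, and_true]
  grind

theorem five_le_card [DecidableEq α] (hc : IsWeakColoring c) (hn : NoAlternatingCycle c)
    {S : Finset α} {p q r s : V}
    (hpq : p ≠ q) (hpr : p ≠ r) (hps : p ≠ s) (hqr : q ≠ r) (hqs : q ≠ s) (hrs : r ≠ s)
    (hS : ∀ u v, u ∈ [p, q, r, s] → v ∈ [p, q, r, s] → u ≠ v → c u v ∈ S) : 5 ≤ S.card := by
  by_cases hpath : ∃ b x y, b ∈ [p, q, r, s] ∧ x ∈ [p, q, r, s] ∧ y ∈ [p, q, r, s] ∧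
      x ≠ b ∧ y ≠ b ∧ x ≠ y ∧ c b x = c b y
  · obtain ⟨b, x, y, hb, hx, hy, hxb, hyb, hxy, h⟩ := hpath
    obtain ⟨z, hz, hzb, hzx, hzy⟩ : ∃ z ∈ [p, q, r, s], z ≠ b ∧ z ≠ x ∧ z ≠ y := by
      classical
      have h4 : [p, q, r, s].toFinset.card = 4 :=
        List.toFinset_card_of_nodup (by simp; tauto)
      obtain ⟨z, hz, hz'⟩ := Finset.exists_mem_notMem_of_card_lt_card
        (Finset.card_le_three.trans_lt (h4 ▸ (by norm_num : 3 < 4)) :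
          ({b, x, y} : Finset V).card < [p, q, r, s].toFinset.card)
      exact ⟨z, by simpa using hz, by simpa using hz'⟩
    refine hc.five_le_card_of_path hxb hyb hxy hzb hzx hzy h fun u v hu hv => hS u v ?_ ?_
    · simp only [List.mem_cons, List.not_mem_nil, or_false] at hu
      rcases hu with rfl | rfl | rfl | rfl <;> assumption
    · simp only [List.mem_cons, List.not_mem_nil, or_false] at hv
      rcases hv with rfl | rfl | rfl | rfl <;> assumption
  · push Not at hpath
    have hne : ∀ b x y, b ∈ [p, q, r, s] → x ∈ [p, q, r, s] → y ∈ [p, q, r, s] →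
      x ≠ b → y ≠ b → x ≠ y → c b x ≠ c b y := hpath
    have hp : p ∈ [p, q, r, s] := by simp
    have hq : q ∈ [p, q, r, s] := by simp
    have hr : r ∈ [p, q, r, s] := by simp
    have hs : s ∈ [p, q, r, s] := by simp
    have e1 := hc.symm p q
    have e2 := hc.symm p r
    have e3 := hc.symm p s
    have e4 := hc.symm q r
    have e5 := hc.symm q s
    have e6 := hc.symm r s
    have m1 := hS p q hp hq hpq
    have m2 := hS p r hp hr hpr
    have m3 := hS p s hp hs hps
    have m4 := hS q r hq hr hqr
    have m5 := hS q s hq hs hqs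
    have m6 := hS r s hr hs hrs
    have p1 := hne p q r hp hq hr hpq.symm hpr.symm hqr
    have p2 := hne p q s hp hq hs hpq.symm hps.symm hqs
    have p3 := hne p r s hp hr hs hpr.symm hps.symm hrs
    have q1 := hne q p r hq hp hr hpq hqr.symm hpr
    have q2 := hne q p s hq hp hs hpq hqs.symm hps
    have q3 := hne q r s hq hr hs hqr.symm hqs.symm hrs
    have r1 := hne r p q hr hp hq hpr hqr hpq
    have r2 := hne r p s hr hp hs hpr hrs.symm hps
    have r3 := hne r q s hr hq hs hqr hrs.symm hqs
    have s1 := hne s p q hs hp hq hps hqs hpq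
    have s2 := hne s p r hs hp hr hps hrs hpr
    have s3 := hne s q r hs hq hr hqs hrs hqr
    have n1 := hn p q r s hpq hpr hps hqr hqs hrs
    have n2 := hn p q s r hpq hps hpr hqs hqr hrs.symm
    have n3 := hn p r q s hpr hpq hps hqr.symm hrs hqs
    clear hne hpath hn hc hS
    by_cases ha : c p q = c r s
    · refine five_le_card_of_distinct m1 m2 m3 m4 m5 ?_
      simp only [List.nodup_cons, List.mem_cons, List.not_mem_nil, or_false, not_or,
        List.nodup_nil, not_false_eq_true, and_true]
      grind
    by_cases hb : c p r = c q s
    · refine five_le_card_of_distinct m1 m2 m3 m4 m6 ?_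
      simp only [List.nodup_cons, List.mem_cons, List.not_mem_nil, or_false, not_or,
        List.nodup_nil, not_false_eq_true, and_true]
      grind
    · refine five_le_card_of_distinct m1 m2 m3 m5 m6 ?_
      simp only [List.nodup_cons, List.mem_cons, List.not_mem_nil, or_false, not_or,
        List.nodup_nil, not_false_eq_true, and_true]
      grind

end IsWeakColoring

/-- Slopes `f` and offsets `C` over a commutative ring which, used coordinatewise in `liftColor`,
destroy every alternating four-cycle. -/
structure IsLiftData {T J R : Type*} [CommRing R] (f : J → T → R) (C : J → T → T → R) : Prop where
  two : IsUnit (2 : R)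
  symm : ∀ κ i j, C κ i j = C κ j i
  diff : ∀ κ {i j}, i ≠ j → IsUnit (f κ i - f κ j)
  mid : ∀ κ {i l} j, i ≠ l → IsUnit (f κ i + f κ l - 2 * f κ j)
  sidon : ∃ κ, (∀ i j, C κ i j = 0) ∧
    ∀ {i k l} j, i ≠ k → i ≠ l → IsUnit (f κ i + f κ j - f κ k - f κ l)
  kill : ∀ {a b c d}, a ≠ b → a ≠ c → a ≠ d → b ≠ c → b ≠ d → c ≠ d →
    ∃ κ, f κ a + f κ c = f κ b + f κ d ∧ C κ a b = 1 ∧ C κ b c = 0 ∧ C κ c d = 0 ∧ C κ d a = 0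

open Classical in
/-- The lift of a coloring of `T` to `T × (J → R)`: edges inside a fibre and edges between equal
positions get their own colors, the remaining ones refine the color of their projection. -/
noncomputable def liftColor {T α J R : Type*} [CommRing R] (c : T → T → α) (f : J → T → R)
    (C : J → T → T → R) (p q : T × (J → R)) : (α × (J → R)) ⊕ ((J → R) ⊕ (J → R)) :=
  if p.1 = q.1 then .inr (.inl (p.2 + q.2))
  else if p.2 = q.2 then .inr (.inr fun κ => p.2 κ + (f κ p.1 + f κ q.1))
  else .inl (c p.1 q.1, fun κ => (f κ q.1 - f κ p.1) * (q.2 κ - p.2 κ) + C κ p.1 q.1)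

section Lift

variable {T α J R : Type*} [CommRing R] {c : T → T → α} {f : J → T → R} {C : J → T → T → R}

theorem liftColor_eq_iff {p q r s : T × (J → R)} :
    liftColor c f C p q = liftColor c f C r s ↔
      (p.1 = q.1 ∧ r.1 = s.1 ∧ ∀ κ, p.2 κ + q.2 κ = r.2 κ + s.2 κ) ∨
      (p.1 ≠ q.1 ∧ r.1 ≠ s.1 ∧ p.2 = q.2 ∧ r.2 = s.2 ∧
        ∀ κ, p.2 κ + (f κ p.1 + f κ q.1) = r.2 κ + (f κ r.1 + f κ s.1)) ∨
      (p.1 ≠ q.1 ∧ r.1 ≠ s.1 ∧ p.2 ≠ q.2 ∧ r.2 ≠ s.2 ∧ c p.1 q.1 = c r.1 s.1 ∧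
        ∀ κ, (f κ q.1 - f κ p.1) * (q.2 κ - p.2 κ) + C κ p.1 q.1 =
          (f κ s.1 - f κ r.1) * (s.2 κ - r.2 κ) + C κ r.1 s.1) := by
  unfold liftColor
  by_cases h1 : p.1 = q.1 <;> by_cases h2 : r.1 = s.1 <;> by_cases h3 : p.2 = q.2 <;>
    by_cases h4 : r.2 = s.2 <;> simp [h1, h2, h3, h4, funext_iff]

theorem liftColor_symm (hf : IsLiftData f C) (hc : IsWeakColoring c) (p q : T × (J → R)) :
    liftColor c f C p q = liftColor c f C q p := by
  rw [liftColor_eq_iff]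
  by_cases h1 : p.1 = q.1
  · exact .inl ⟨h1, h1.symm, fun κ => add_comm _ _⟩
  by_cases h2 : p.2 = q.2
  · exact .inr (.inl ⟨h1, Ne.symm h1, h2, h2.symm, fun κ => by rw [h2]; ring⟩)
  · exact .inr (.inr ⟨h1, Ne.symm h1, h2, Ne.symm h2, hc.symm _ _, fun κ => by
      rw [hf.symm]; ring⟩)

theorem eq_of_isUnit_mul_sub {u a b : R} (hu : IsUnit u) (h : u * (a - b) = 0) : a = b :=
  sub_eq_zero.1 (hu.mul_right_eq_zero.1 h)

/-- A monochromatic path of the lift lies over a monochromatic path of the base. -/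
theorem IsLiftData.path [Nontrivial R] (hf : IsLiftData f C) {b x y : T × (J → R)} (hxy : x ≠ y) (h : liftColor c f C b x = liftColor c f C b y) :
    x.1 ≠ b.1 ∧ y.1 ≠ b.1 ∧ x.1 ≠ y.1 ∧ c b.1 x.1 = c b.1 y.1 ∧
      ∀ κ, (f κ x.1 - f κ b.1) * (x.2 κ - b.2 κ) + C κ b.1 x.1 =
        (f κ y.1 - f κ b.1) * (y.2 κ - b.2 κ) + C κ b.1 y.1 := by
  obtain ⟨κ₀, h0, hs⟩ := hf.sidon
  rcases liftColor_eq_iff.1 h with ⟨h1, h2, h3⟩ | ⟨h1, h2, h3, h4, h5⟩ | ⟨h1, h2, h3, h4, h5, h6⟩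
  · exact absurd (Prod.ext (h1.symm.trans h2) (funext fun κ => add_left_cancel (h3 κ))) hxy
  · have h6 : x.1 ≠ y.1 := fun e => hxy (Prod.ext e (h3.symm.trans h4))
    have hu := hf.diff κ₀ h6
    rw [show f κ₀ x.1 - f κ₀ y.1 = 0 by linear_combination h5 κ₀] at hu
    exact absurd hu not_isUnit_zero
  · refine ⟨Ne.symm h1, Ne.symm h2, fun e => ?_, h5, h6⟩
    refine hxy (Prod.ext e (funext fun κ => ?_))
    refine eq_of_isUnit_mul_sub (hf.diff κ (Ne.symm h1)) ?_
    have := h6 κ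
    rw [← e] at this
    linear_combination this

theorem IsLiftData.isWeakColoring [Nontrivial R] (hf : IsLiftData f C) (hc : IsWeakColoring c) :
    IsWeakColoring (liftColor c f C) where
  symm := liftColor_symm hf hc
  center := by
    intro b x y z hxb hyb hxy h hzb hz
    by_contra! hne
    obtain ⟨p1, p2, p3, p4, -⟩ := hf.path hxy h
    obtain ⟨q1, q2, q3, q4, -⟩ := hf.path hne.1 hz
    obtain ⟨r1, r2, r3, r4, -⟩ := hf.path hne.2 (hz.trans h)
    exact (hc.center p1 p2 p3 p4 q1 q4).elim q3 r3
  leaf := by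
    intro b x y z hxb hyb hxy h hzx hz
    by_contra hne
    obtain ⟨p1, p2, p3, p4, -⟩ := hf.path hxy h
    obtain ⟨q1, q2, q3, q4, -⟩ := hf.path hne
      (hz.trans (liftColor_symm hf hc b x))
    exact q3 (hc.leaf p1 p2 p3 p4 q1 (q4.trans (hc.symm _ _)))
  base := by
    intro b x y z hxb hyb hxy h hzx hz
    by_contra hne
    obtain ⟨p1, p2, p3, p4, -⟩ := hf.path hxy h
    obtain ⟨q1, q2, q3, q4, -⟩ := hf.path hne hz
    exact q3 (hc.base p1 p2 p3 p4 q1 q4)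
  avoid := by
    intro b x y z hxb hyb hxy h hzb hz
    obtain ⟨p1, p2, p3, p4, p5⟩ := hf.path hxy h
    rcases liftColor_eq_iff.1 hz with ⟨-, h2, -⟩ | ⟨h1, h2, h3, h4, h5⟩ | ⟨h1, -, -, -, h5, -⟩
    · exact p3 h2
    · obtain ⟨κ, h0, hs⟩ := hf.sidon
      have e := p5 κ
      rw [h0, h0, ← h4] at e
      have e' : x.2 κ = b.2 κ := eq_of_isUnit_mul_sub (hf.diff κ p3) (by linear_combination e)
      have hu := hs z.1 (Ne.symm p1) (Ne.symm p2)
      rw [show f κ b.1 + f κ z.1 - f κ x.1 - f κ y.1 = 0 by linear_combination h5 κ + e'] at hu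
      exact not_isUnit_zero hu
    · exact hc.avoid p1 p2 p3 p4 (Ne.symm h1) h5
  unique := by
    intro b x y z hxb hyb hxy h hzx hzy hz
    obtain ⟨p1, p2, p3, p4, p5⟩ := hf.path hxy h
    obtain ⟨q1, q2, q3, q4, q5⟩ := hf.path hxy hz
    have e := hc.unique p1 p2 p3 p4 (Ne.symm q1) (Ne.symm q2) q4
    refine Prod.ext e (funext fun κ => eq_of_isUnit_mul_sub (hf.diff κ p3) ?_)
    have e1 := p5 κ
    have e2 := q5 κ
    rw [e] at e2
    linear_combination e1 - e2

theorem IsLiftData.not_alternating_of_fibre (hf : IsLiftData f C) {p q r s : T × (J → R)}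
    (hpq : p ≠ q) (hpr : p ≠ r) (h : liftColor c f C p q = liftColor c f C r s)
    (h' : liftColor c f C q r = liftColor c f C s p) (h1 : p.1 = q.1) : False := by
  rcases liftColor_eq_iff.1 h with ⟨-, h2, h3⟩ | ⟨h2, -⟩ | ⟨h2, -⟩
  rotate_left
  · exact h2 h1
  · exact h2 h1
  rcases liftColor_eq_iff.1 h' with ⟨h4, h5, h6⟩ | ⟨h4, h5, h6, h7, h8⟩ |
    ⟨h4, h5, h6, h7, h8, h9⟩
  · refine hpr (Prod.ext (h1.trans h4) (funext fun κ => eq_of_isUnit_mul_sub hf.two ?_))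
    linear_combination h3 κ - h6 κ
  · refine hpq (Prod.ext h1 (funext fun κ => ?_))
    have e := h8 κ
    rw [h1, h2, h7] at e
    linear_combination -e
  · refine h6 (funext fun κ => (eq_of_isUnit_mul_sub hf.two ?_).symm)
    have e := h9 κ
    rw [h1, ← h2, hf.symm κ r.1] at e
    have e' : r.2 κ - q.2 κ = s.2 κ - p.2 κ :=
      eq_of_isUnit_mul_sub (hf.diff κ (Ne.symm h4)) (by linear_combination e)
    linear_combination e' - h3 κ

theorem IsLiftData.not_alternating_of_vertical [Nontrivial R] (hf : IsLiftData f C)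
    {p q r s : T × (J → R)} (hqs : q ≠ s) (h : liftColor c f C p q = liftColor c f C r s)
    (h' : liftColor c f C q r = liftColor c f C s p) (h1 : p.1 ≠ q.1) (h2 : p.2 = q.2)
    (h3 : q.1 ≠ r.1) : False := by
  rcases liftColor_eq_iff.1 h with ⟨h4, -⟩ | ⟨-, h4, -, h5, h6⟩ | ⟨-, -, h4, -⟩
  · exact h1 h4
  rotate_left
  · exact h4 h2
  obtain ⟨κ, h0, hs⟩ := hf.sidon
  rcases liftColor_eq_iff.1 h' with ⟨h7, -⟩ | ⟨-, h7, h8, h9, h10⟩ | ⟨-, h7, h8, h9, h10, h11⟩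
  · exact h3 h7
  · have e := h10 κ
    have hu := hs p.1 h3 fun e => hqs (Prod.ext e (h8.trans h5))
    rw [show f κ q.1 + f κ p.1 - f κ r.1 - f κ s.1 = 0 by
      rw [h2, h8] at h6; linear_combination h6 κ] at hu
    exact not_isUnit_zero hu
  · have e := h11 κ
    rw [h0, h0, ← h2, h5] at e
    have e1 : s.2 κ = p.2 κ :=
      eq_of_isUnit_mul_sub (hs p.1 (Ne.symm h3) h4) (by linear_combination e)
    have e2 := h6 κ
    rw [h5, e1] at e2
    by_cases hpr : p.1 = r.1
    · by_cases hqs : q.1 = s.1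
      · refine h8 (funext fun κ => ?_)
        have e3 := h6 κ
        rw [hpr, hqs] at e3
        rw [← h2]
        exact add_right_cancel e3
      · have hu := hf.diff κ hqs
        rw [show f κ q.1 - f κ s.1 = 0 by rw [hpr] at e2; linear_combination e2] at hu
        exact not_isUnit_zero hu
    · have hu := hs q.1 hpr (Ne.symm h7)
      rw [show f κ p.1 + f κ q.1 - f κ r.1 - f κ s.1 = 0 by linear_combination e2] at hu
      exact not_isUnit_zero hu

theorem IsLiftData.noAlternatingCycle [Nontrivial R] (hf : IsLiftData f C) :
    NoAlternatingCycle (liftColor c f C) := by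
  intro p q r s hpq hpr hps hqr hqs hrs h h'
  have hF := fun e => hf.not_alternating_of_fibre hpq hpr h h' e
  have hF' := fun e => hf.not_alternating_of_fibre hqr hqs h' h.symm e
  have hV := fun e => hf.not_alternating_of_vertical hqs h h' hF e hF'
  rcases liftColor_eq_iff.1 h with ⟨h1, -⟩ | ⟨-, -, h1, -⟩ | ⟨h1, h2, h3, h4, -, E⟩
  · exact hF h1
  · exact hV h1
  rcases liftColor_eq_iff.1 h' with ⟨h5, -⟩ | ⟨-, -, h5, -⟩ | ⟨h5, h6, h7, h8, -, E'⟩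
  · exact hF' h5
  · exact hf.not_alternating_of_vertical hpr.symm h' h.symm hF' h5 h2
  by_cases hi : p.1 = r.1 <;> by_cases hj : q.1 = s.1
  · refine hpr (Prod.ext hi (funext fun κ => ?_))
    have e := E κ
    have e' := E' κ
    rw [← hi, ← hj] at e
    rw [← hi, ← hj] at e'
    have e1 := eq_of_isUnit_mul_sub (a := q.2 κ - p.2 κ) (b := s.2 κ - r.2 κ)
      (hf.diff κ (Ne.symm h1)) (by linear_combination e)
    have e2 := eq_of_isUnit_mul_sub (a := r.2 κ - q.2 κ) (b := p.2 κ - s.2 κ)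
      (hf.diff κ h1) (by linear_combination e')
    exact eq_of_isUnit_mul_sub hf.two (by linear_combination -e1 - e2)
  · refine hpr (Prod.ext hi (funext fun κ => (eq_of_isUnit_mul_sub (hf.mid κ p.1 hj) ?_).symm))
    have e := E κ
    have e' := E' κ
    rw [← hi] at e e'
    rw [hf.symm κ q.1, hf.symm κ s.1] at e'
    linear_combination e - e'
  · have hqs' : q.2 = s.2 := funext fun κ => eq_of_isUnit_mul_sub (hf.mid κ q.1 hi) (by
      have e := E κ
      have e' := E' κ
      rw [← hj] at e e'
      rw [hf.symm κ r.1] at e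
      rw [hf.symm κ q.1 p.1] at e'
      linear_combination -e - e')
    exact hqs (Prod.ext hj hqs')
  · obtain ⟨κ, e1, e2, e3, e4, e5⟩ := hf.kill h1 hi (Ne.symm h6) h5 hj h2
    have e := E κ
    have e' := E' κ
    rw [e2, e4] at e
    rw [e3, e5] at e'
    have e6 := eq_of_isUnit_mul_sub (a := r.2 κ - q.2 κ) (b := s.2 κ - p.2 κ)
      (hf.diff κ (Ne.symm h5)) (by linear_combination e' + e1 * (p.2 κ - s.2 κ))
    exact one_ne_zero (α := R)
      (by linear_combination e - (s.2 κ - r.2 κ) * e1 + (f κ q.1 - f κ p.1) * e6)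

end Lift

section Ternary

variable {ι : Type*}

/-- A coordinate at which `v` does not vanish, the same for `v` and its nonzero multiples. -/
noncomputable def leadIndex [Nonempty ι] (v : ι → ZMod 3) : ι :=
  Classical.epsilon fun e => v e ≠ 0

/-- The one of `w` and `-w` whose leading coordinate is `1`. -/
noncomputable def signNormalize [Nonempty ι] (w : (ι → ZMod 3) × ZMod 3) :
    (ι → ZMod 3) × ZMod 3 :=
  w.1 (leadIndex w.1) • w

open Classical in
/-- A weak coloring of the affine space `(ι → ZMod 3) × ZMod 3` whose monochromatic paths are lines
of that space. -/
noncomputable def ternaryColor [Nonempty ι] (x y : (ι → ZMod 3) × ZMod 3) :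
    ZMod 3 ⊕ ((ι → ZMod 3) ⊕ ((ι → ZMod 3) × ZMod 3)) :=
  if x.1 = y.1 then .inl (x.2 + y.2)
  else if (-(x.1 + y.1)) (leadIndex (y.1 - x.1)) = (signNormalize (y - x)).2 then
    .inr (.inl (-(x.1 + y.1)))
  else .inr (.inr (signNormalize (y - x)))

theorem ternary_sub_eq {x y b : (ι → ZMod 3) × ZMod 3} (h : x + y + b = 0) : y - x = x - b := by
  have h3 : (3 : ZMod 3) = 0 := rfl
  refine Prod.ext (funext fun e => ?_) ?_
  · have h1 := congrFun (congrArg Prod.fst h) e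
    simp only [Prod.fst_add, Pi.add_apply, Prod.fst_zero, Pi.zero_apply, Prod.fst_sub,
      Pi.sub_apply] at h1 ⊢
    linear_combination h1 - x.1 e * h3
  · have h1 := congrArg Prod.snd h
    simp only [Prod.snd_add, Prod.snd_zero, Prod.snd_sub] at h1 ⊢
    linear_combination h1 - x.2 * h3

theorem ternary_add_eq_zero {x y b : (ι → ZMod 3) × ZMod 3} (h : x - b = -(y - b)) :
    x + y + b = 0 := by
  have h3 : (3 : ZMod 3) = 0 := rfl
  refine Prod.ext (funext fun e => ?_) ?_
  · have h1 := congrFun (congrArg Prod.fst h) e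
    simp only [Prod.fst_add, Pi.add_apply, Prod.fst_zero, Pi.zero_apply, Prod.fst_sub,
      Pi.sub_apply, Prod.fst_neg, Pi.neg_apply] at h1 ⊢
    linear_combination h1 + b.1 e * h3
  · have h1 := congrArg Prod.snd h
    simp only [Prod.snd_add, Prod.snd_zero, Prod.snd_sub, Prod.snd_neg] at h1 ⊢
    linear_combination h1 + b.2 * h3

variable [Nonempty ι]

theorem apply_leadIndex_ne_zero {v : ι → ZMod 3} (hv : v ≠ 0) : v (leadIndex v) ≠ 0 :=
  Classical.epsilon_spec (p := fun e => v e ≠ 0) (Function.ne_iff.1 hv)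

theorem leadIndex_smul (v : ι → ZMod 3) {a : ZMod 3} (ha : a ≠ 0) :
    leadIndex (a • v) = leadIndex v := by
  unfold leadIndex
  congr 1
  ext e
  simp [ha]

theorem leadIndex_neg (v : ι → ZMod 3) : leadIndex (-v) = leadIndex v := by
  unfold leadIndex
  congr 1
  ext e
  simp

theorem leadIndex_sub_comm (v w : ι → ZMod 3) : leadIndex (v - w) = leadIndex (w - v) := by
  rw [← neg_sub, leadIndex_neg]

theorem signNormalize_neg (w : (ι → ZMod 3) × ZMod 3) : signNormalize (-w) = signNormalize w := by
  unfold signNormalize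
  rw [Prod.fst_neg, leadIndex_neg, Pi.neg_apply, smul_neg, neg_smul, neg_neg]

theorem signNormalize_eq_or {w : (ι → ZMod 3) × ZMod 3} (hw : w.1 ≠ 0) :
    signNormalize w = w ∨ signNormalize w = -w := by
  have h : ∀ a : ZMod 3, a ≠ 0 → a = 1 ∨ a = -1 := by decide
  unfold signNormalize
  rcases h _ (apply_leadIndex_ne_zero hw) with h | h <;> simp [h]

theorem signNormalize_apply_leadIndex {w : (ι → ZMod 3) × ZMod 3} (hw : w.1 ≠ 0) :
    (signNormalize w).1 (leadIndex (signNormalize w).1) = 1 := by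
  have h : ∀ a : ZMod 3, a ≠ 0 → a * a = 1 := by decide
  have hne := apply_leadIndex_ne_zero hw
  unfold signNormalize
  rw [Prod.smul_fst, leadIndex_smul _ hne, Pi.smul_apply, smul_eq_mul, h _ hne]

theorem eq_or_eq_neg_of_signNormalize_eq {w w' : (ι → ZMod 3) × ZMod 3} (hw : w.1 ≠ 0)
    (hw' : w'.1 ≠ 0) (h : signNormalize w = signNormalize w') : w = w' ∨ w = -w' := by
  rcases signNormalize_eq_or hw with h1 | h1 <;> rcases signNormalize_eq_or hw' with h2 | h2 <;>
    rw [h1, h2] at h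
  · exact .inl h
  · exact .inr h
  · exact .inr (neg_eq_iff_eq_neg.1 h)
  · exact .inl (neg_injective h)

theorem ternaryColor_symm (x y : (ι → ZMod 3) × ZMod 3) : ternaryColor x y = ternaryColor y x := by
  unfold ternaryColor
  rw [leadIndex_sub_comm, add_comm x.1, ← neg_sub x y, signNormalize_neg, add_comm x.2]
  by_cases h : x.1 = y.1
  · rw [if_pos h, if_pos h.symm]
  · rw [if_neg h, if_neg (Ne.symm h)]

/-- The monochromatic paths of `ternaryColor`. -/
theorem ternaryColor_path {b x y : (ι → ZMod 3) × ZMod 3} (hxy : x ≠ y)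
    (h : ternaryColor b x = ternaryColor b y) :
    x + y + b = 0 ∧ ternaryColor x y = .inr (.inl b.1) ∧
      ternaryColor b x = .inr (.inr (signNormalize (x - b))) := by
  by_cases hx : b.1 = x.1
  · by_cases hy : b.1 = y.1
    · exact absurd (Prod.ext (hx.symm.trans hy) (by simpa [ternaryColor, hx, ← hy] using h)) hxy
    · unfold ternaryColor at h
      rw [if_pos hx, if_neg hy] at h
      split_ifs at h
  by_cases hy : b.1 = y.1
  · unfold ternaryColor at h
    rw [if_neg hx, if_pos hy] at h
    split_ifs at h
  have hx0 : (x - b).1 ≠ 0 := sub_ne_zero.2 (Ne.symm hx)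
  have hy0 : (y - b).1 ≠ 0 := sub_ne_zero.2 (Ne.symm hy)
  by_cases hx' : (-(b.1 + x.1)) (leadIndex (x.1 - b.1)) = (signNormalize (x - b)).2 <;>
    by_cases hy' : (-(b.1 + y.1)) (leadIndex (y.1 - b.1)) = (signNormalize (y - b)).2
  · simp only [ternaryColor, if_neg hx, if_neg hy, if_pos hx', if_pos hy', Sum.inr.injEq,
      Sum.inl.injEq] at h
    have e : x.1 = y.1 := add_left_cancel (neg_injective h)
    have hx1 : (x - b).1 = (y - b).1 := by simp [e]
    refine absurd (Prod.ext e ?_) hxy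
    rw [e, hy', signNormalize, signNormalize, hx1] at hx'
    have := mul_left_cancel₀ (apply_leadIndex_ne_zero hy0) hx'
    exact (sub_left_injective this).symm
  · simp only [ternaryColor, if_neg hx, if_neg hy, hx', hy', if_true, if_false, reduceCtorEq,
      Sum.inr.injEq] at h
  · simp only [ternaryColor, if_neg hx, if_neg hy, hx', hy', if_true, if_false, reduceCtorEq,
      Sum.inr.injEq] at h
  have h' := h
  simp only [ternaryColor, if_neg hx, if_neg hy, if_neg hx', if_neg hy', Sum.inr.injEq] at h'
  rcases eq_or_eq_neg_of_signNormalize_eq hx0 hy0 h' with e | e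
  · exact absurd (sub_left_injective e) hxy
  have hs := ternary_add_eq_zero e
  have hd := ternary_sub_eq hs
  have hd1 : y.1 - x.1 = x.1 - b.1 := congrArg Prod.fst hd
  have hb : -(x.1 + y.1) = b.1 := neg_eq_of_add_eq_zero_right (congrArg Prod.fst hs)
  have hbx : -(b.1 + x.1) = y.1 := by rw [← hb]; abel
  have hby : -(b.1 + y.1) = x.1 := by rw [← hb]; abel
  have hl : leadIndex (y.1 - b.1) = leadIndex (x.1 - b.1) := by
    rw [show y.1 - b.1 = -(x.1 - b.1) from (neg_eq_iff_eq_neg.2 (congrArg Prod.fst e)).symm,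
      leadIndex_neg]
  have hne : x.1 ≠ y.1 := fun e' => by
    rw [e', sub_self] at hd1
    exact hx0 (by rw [Prod.fst_sub, e', ← hd1])
  have hle := apply_leadIndex_ne_zero hx0
  refine ⟨hs, ?_, by rw [ternaryColor, if_neg hx, if_neg hx']⟩
  unfold ternaryColor
  rw [if_neg hne, hb, hd1, hd, if_pos]
  have key : ∀ a b' c w : ZMod 3, a - b' ≠ 0 → c - a = a - b' → c ≠ w → a ≠ w → b' = w := by
    decide
  rw [hbx] at hx'
  rw [hby, hl, ← h'] at hy'
  exact key _ _ _ _ hle (congrFun hd1 _) hx' hy'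

theorem isWeakColoring_ternaryColor :
    IsWeakColoring (ternaryColor (ι := ι)) where
  symm := ternaryColor_symm
  center := by
    intro b x y z hxb hyb hxy h hzb hz
    by_contra! hne
    have h1 := (ternaryColor_path hxy h).1
    have h2 := (ternaryColor_path hne.1 hz).1
    rw [add_comm x y, ← h2] at h1
    exact hne.2 (add_right_cancel (add_right_cancel h1)).symm
  leaf := by
    intro b x y z hxb hyb hxy h hzx hz
    by_contra hne
    obtain ⟨h1, h2, h3⟩ := ternaryColor_path hxy h
    obtain ⟨h4, h5, h6⟩ := ternaryColor_path hne (hz.trans (ternaryColor_symm _ _))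
    rw [← h1, show x + y + b = y + b + x by abel] at h4
    rw [add_right_cancel (add_right_cancel h4), h2, h3] at hz
    simp at hz
  base := by
    intro b x y z hxb hyb hxy h hzx hz
    by_contra hne
    obtain ⟨h1, h2, h3⟩ := ternaryColor_path hxy h
    obtain ⟨h4, h5, h6⟩ := ternaryColor_path hne hz
    rw [hz, h2] at h6
    simp at h6
  avoid := by
    intro b x y z hxb hyb hxy h hzb hz
    obtain ⟨h1, h2, h3⟩ := ternaryColor_path hxy h
    rw [h2] at hz
    unfold ternaryColor at hz
    split_ifs at hz with h4 h5
    · have h3 : (3 : ZMod 3) = 0 := rfl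
      refine h4 (funext fun e => ?_)
      have h6 := congrFun (Sum.inl_injective (Sum.inr_injective hz)) e
      simp only [Pi.neg_apply, Pi.add_apply] at h6
      linear_combination h6 + b.1 e * h3
    · simp at hz
  unique := by
    intro b x y z hxb hyb hxy h hzx hzy hz
    have h1 := (ternaryColor_path hxy h).1
    have h2 := (ternaryColor_path hxy hz).1
    exact add_left_cancel (h2.trans h1.symm)

open Classical in
theorem exists_ternaryColor_palette [Fintype ι] :
    ∃ A : Finset (ZMod 3 ⊕ ((ι → ZMod 3) ⊕ ((ι → ZMod 3) × ZMod 3))),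
      (∀ x y, x ≠ y → ternaryColor x y ∈ A) ∧ 2 * A.card ≤ 6 + 5 * 3 ^ Fintype.card ι := by
  let W : Finset ((ι → ZMod 3) × ZMod 3) := Finset.univ.filter fun w => w.1 (leadIndex w.1) = 1
  refine ⟨Finset.univ.disjSum (Finset.univ.disjSum W), fun x y hxy => ?_, ?_⟩
  · unfold ternaryColor
    split_ifs with h1 h2
    · simp
    · simp
    · have : (y - x).1 ≠ 0 := sub_ne_zero.2 (Ne.symm h1)
      simp [W, signNormalize_apply_leadIndex this]
  · have hW : 2 * W.card ≤ 3 ^ Fintype.card ι * 3 := by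
      have hd : Disjoint W (W.image fun w => -w) := by
        rw [Finset.disjoint_left]
        intro w hw hw'
        obtain ⟨u, hu, rfl⟩ := Finset.mem_image.1 hw'
        simp only [W, Finset.mem_filter, Finset.mem_univ, true_and, Prod.fst_neg,
          leadIndex_neg, Pi.neg_apply] at hw hu
        rw [hu] at hw
        exact absurd hw (by decide)
      have h := Finset.card_le_univ (W ∪ W.image fun w => -w)
      rw [Finset.card_union_of_disjoint hd, Finset.card_image_of_injective _ neg_injective] at h
      simpa [ZMod.card, two_mul] using h
    simp only [Finset.card_disjSum, Finset.card_univ, ZMod.card, Fintype.card_fun]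
    omega

end Ternary

section LiftData

theorem three_pow_add_ne {i j k l : ℕ} (hik : i ≠ k) (hil : i ≠ l) :
    3 ^ i + 3 ^ j ≠ 3 ^ k + 3 ^ l := by
  induction i generalizing j k l with
  | zero =>
    obtain ⟨k, rfl⟩ := Nat.exists_eq_succ_of_ne_zero hik.symm
    obtain ⟨l, rfl⟩ := Nat.exists_eq_succ_of_ne_zero hil.symm
    rcases j with _ | j <;> simp only [pow_succ, pow_zero] <;> omega
  | succ i ih =>
    intro h
    rcases j with _ | j <;> rcases k with _ | k <;> rcases l with _ | l <;>
      simp only [pow_succ, pow_zero] at h <;> try omega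
    · exact hil (congrArg Nat.succ (Nat.pow_right_injective (by norm_num : 2 ≤ 3) (by
        show 3 ^ i = 3 ^ l
        omega)))
    · exact hik (congrArg Nat.succ (Nat.pow_right_injective (by norm_num : 2 ≤ 3) (by
        show 3 ^ i = 3 ^ k
        omega)))
    · exact ih (by omega) (by omega) (show 3 ^ i + 3 ^ j = 3 ^ k + 3 ^ l by omega)

variable {T : Type}

open Classical in
/-- Slopes taking the values `0, 1, 5, 4` at `a, b, c, d`, with no three-term progression. -/
noncomputable def killSlope (e : T → ℕ) (a b c d t : T) : ℤ :=
  if t = a then 0 else if t = b then 1 else if t = c then 5 else if t = d then 4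
  else 20 * 3 ^ e t

theorem killSlope_add_ne {e : T → ℕ} (he : e.Injective) {a b c d i l : T} (j : T) (hil : i ≠ l) :
    killSlope e a b c d i + killSlope e a b c d l ≠ 2 * killSlope e a b c d j := by
  have hodd : ∀ t, ∃ u : ℕ, (3 : ℤ) ^ e t = 2 * u + 1 := fun t => by
    obtain ⟨u, hu⟩ := (by decide : Odd 3).pow (n := e t)
    exact ⟨u, by exact_mod_cast hu⟩
  obtain ⟨x, hx⟩ := hodd i
  obtain ⟨y, hy⟩ := hodd j
  obtain ⟨z, hz⟩ := hodd l
  have hpow : x + z ≠ 2 * y := by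
    intro h
    have h' : (3 : ℤ) ^ e i + 3 ^ e l = 3 ^ e j + 3 ^ e j := by
      rw [hx, hy, hz]; exact_mod_cast (by omega)
    by_cases hij : i = j
    · subst hij
      exact hil (he (Nat.pow_right_injective (by norm_num : 2 ≤ 3) (by
        have : (3 : ℤ) ^ e l = 3 ^ e i := add_left_cancel h'
        exact_mod_cast this.symm)))
    · exact three_pow_add_ne (he.ne hij) (he.ne hij) (by exact_mod_cast h')
  unfold killSlope
  rw [hx, hy, hz]
  split_ifs <;> first | omega | (subst_vars; contradiction)

theorem exists_integral_liftData (T : Type) [Finite T] :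
    ∃ (J : Type) (_ : Fintype J) (f : J → T → ℤ) (C : J → T → T → ℤ),
      (∀ κ i j, C κ i j = C κ j i) ∧
      (∀ κ {i l} j, i ≠ l → f κ i + f κ l - 2 * f κ j ≠ 0) ∧
      (∃ κ, (∀ i j, C κ i j = 0) ∧
        ∀ {i k l} j, i ≠ k → i ≠ l → f κ i + f κ j - f κ k - f κ l ≠ 0) ∧
      ∀ {a b c d}, a ≠ b → a ≠ c → a ≠ d → b ≠ c → b ≠ d → c ≠ d → ∃ κ,
        f κ a + f κ c = f κ b + f κ d ∧ C κ a b = 1 ∧ C κ b c = 0 ∧ C κ c d = 0 ∧ C κ d a = 0 := by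
  classical
  obtain ⟨n, ⟨e⟩⟩ := Finite.exists_equiv_fin T
  let g : T → ℕ := fun t => e t
  have hg : g.Injective := Fin.val_injective.comp e.injective
  have := Fintype.ofFinite T
  have hs : ∀ {i k l : T} (j : T), i ≠ k → i ≠ l →
      (3 : ℤ) ^ g i + 3 ^ g j - 3 ^ g k - 3 ^ g l ≠ 0 := fun j hik hil h =>
    three_pow_add_ne (hg.ne hik) (hg.ne hil) (j := g j) (by zify; linarith)
  refine ⟨Option (T × T × T × T), inferInstance,
    fun κ t => κ.elim (3 ^ g t) fun v => killSlope g v.1 v.2.1 v.2.2.1 v.2.2.2 t,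
    fun κ i j => κ.elim 0 fun v =>
      if (i = v.1 ∧ j = v.2.1) ∨ (i = v.2.1 ∧ j = v.1) then 1 else 0, ?_, ?_, ?_, ?_⟩
  · rintro (_ | v) i j
    · rfl
    · simp only [Option.elim_some]
      congr 1
      grind
  · rintro (_ | v) i l j hil
    · simp only [Option.elim_none]
      by_cases hij : i = j
      · subst hij
        have := hs l (Ne.symm hil) (Ne.symm hil)
        intro h
        exact this (by linarith)
      · have := hs l hij hij
        intro h
        exact this (by linarith)
    · exact fun h => killSlope_add_ne hg j hil (sub_eq_zero.1 h)
  · exact ⟨none, fun _ _ => rfl, hs⟩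
  · intro a b c d hab hac had hbc hbd hcd
    refine ⟨some (a, b, c, d), ?_⟩
    simp [killSlope, hab.symm, hac.symm, had.symm, hbc.symm, hbd.symm, hcd.symm, hab]

theorem isUnit_intCast_zmod {L t : ℕ} {z : ℤ} (hz : z ∣ L) : IsUnit (z : ZMod (1 + t * L)) := by
  obtain ⟨k, hk⟩ := hz
  have h : ((1 + t * L : ℕ) : ZMod (1 + t * L)) = 0 := ZMod.natCast_self _
  have hk' : (L : ZMod (1 + t * L)) = z * k := by
    have := congrArg (Int.cast (R := ZMod (1 + t * L))) hk
    push_cast at this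
    exact this
  push_cast at h
  rw [hk'] at h
  exact IsUnit.of_mul_eq_one (-(t * k)) (by linear_combination -h)

theorem exists_liftData (T : Type) [Finite T] :
    ∃ (J : Type) (_ : Fintype J) (L : ℕ), 0 < L ∧ ∀ t : ℕ,
      ∃ (f : J → T → ZMod (1 + t * L)) (C : J → T → T → ZMod (1 + t * L)), IsLiftData f C := by
  obtain ⟨J, hJ, f, C, h1, h2, ⟨κ₀, h3, h4⟩, h5⟩ := exists_integral_liftData T
  obtain ⟨M, hM⟩ : ∃ M : ℕ, ∀ κ t, |f κ t| ≤ M := by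
    obtain ⟨M, hM⟩ := Set.Finite.bddAbove (Set.finite_range fun v : J × T => (f v.1 v.2).natAbs)
    exact ⟨M, fun κ t => by
      rw [Int.abs_eq_natAbs]; exact_mod_cast hM ⟨(κ, t), rfl⟩⟩
  refine ⟨J, hJ, (4 * M + 2).factorial, Nat.factorial_pos _, fun t => ?_⟩
  have key : ∀ z : ℤ, z ≠ 0 → |z| ≤ 4 * M + 2 →
      IsUnit (z : ZMod (1 + t * (4 * M + 2).factorial)) := fun z hz hzM =>
    isUnit_intCast_zmod (Int.natAbs_dvd.1 (by
      exact_mod_cast Nat.dvd_factorial (Int.natAbs_pos.2 hz)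
        (by rw [Int.abs_eq_natAbs] at hzM; omega)))
  have hb : ∀ κ s, -(M : ℤ) ≤ f κ s ∧ f κ s ≤ M := fun κ s => abs_le.1 (hM κ s)
  refine ⟨fun κ s => f κ s, fun κ i j => C κ i j, ?_, ?_, ?_, ?_, ?_, ?_⟩
  · exact_mod_cast key 2 (by norm_num) (by rw [abs_le]; omega)
  · intro κ i j
    rw [h1]
  · intro κ i j hij
    have h := h2 κ j hij
    exact_mod_cast key (f κ i - f κ j) (fun h' => h (by linarith)) (by
      have := hb κ i; have := hb κ j; rw [abs_le]; omega)
  · intro κ i l j hil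
    exact_mod_cast key _ (h2 κ j hil) (by
      have := hb κ i; have := hb κ j; have := hb κ l; rw [abs_le]; omega)
  · refine ⟨κ₀, fun i j => by simp [h3], fun {i k l} j hik hil => ?_⟩
    exact_mod_cast key _ (h4 j hik hil) (by
      have := hb κ₀ i; have := hb κ₀ j; have := hb κ₀ l; have := hb κ₀ k; rw [abs_le]; omega)
  · intro a b c d hab hac had hbc hbd hcd
    obtain ⟨κ, e1, e2, e3, e4, e5⟩ := h5 hab hac had hbc hbd hcd
    exact ⟨κ, by exact_mod_cast congrArg (Int.cast (R := ZMod _)) e1, by simp [e2], by simp [e3],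
      by simp [e4], by simp [e5]⟩

end LiftData

section LowerBound

variable {n : ℕ} {χ : Fin n → Fin n → ℕ}

theorem IsPQColoring.not_subset (hχ : IsPQColoring n 4 5 χ) {p q r s : Fin n} (hpq : p ≠ q)
    (hpr : p ≠ r) (hps : p ≠ s) (hqr : q ≠ r) (hqs : q ≠ s) (hrs : r ≠ s) {L : Finset ℕ}
    (hL : L.card ≤ 4) (h1 : χ p q ∈ L) (h2 : χ p r ∈ L) (h3 : χ p s ∈ L) (h4 : χ q r ∈ L)
    (h5 : χ q s ∈ L) (h6 : χ r s ∈ L) : False := by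
  have h := hχ.2 {p, q, r, s} (by simp [*])
  have hsub : spannedColors χ {p, q, r, s} ⊆ L := by
    intro κ hκ
    simp only [spannedColors, Finset.mem_image, Finset.mem_filter, Finset.mem_product,
      Finset.mem_insert, Finset.mem_singleton] at hκ
    obtain ⟨⟨u, v⟩, ⟨⟨hu, hv⟩, huv⟩, rfl⟩ := hκ
    have := hχ.1
    grind
  exact absurd (h.trans (Finset.card_le_card hsub)) (by omega)

theorem IsPQColoring.eq_of_star (hχ : IsPQColoring n 4 5 χ) {b x y z : Fin n} (hxb : x ≠ b)
    (hyb : y ≠ b) (hzb : z ≠ b) (hxy : x ≠ y) (hxz : x ≠ z) (h : χ b x = χ b y)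
    (h' : χ b x = χ b z) : y = z := by
  by_contra hyz
  refine hχ.not_subset hxb.symm hyb.symm hzb.symm hxy hxz hyz
    (L := {χ b x, χ x y, χ x z, χ y z}) Finset.card_le_four ?_ ?_ ?_ ?_ ?_ ?_ <;> simp [← h, ← h']

theorem IsPQColoring.eq_of_common_base (hχ : IsPQColoring n 4 5 χ) {b b' x y : Fin n}
    (hxb : x ≠ b) (hyb : y ≠ b) (hxb' : x ≠ b') (hyb' : y ≠ b') (hxy : x ≠ y)
    (h : χ b x = χ b y) (h' : χ b' x = χ b' y) : b = b' := by
  by_contra hb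
  refine hχ.not_subset hb hxb.symm hyb.symm hxb'.symm hyb'.symm hxy
    (L := {χ b x, χ b' x, χ x y, χ b b'}) Finset.card_le_four ?_ ?_ ?_ ?_ ?_ ?_ <;> simp [← h, ← h']

theorem IsPQColoring.not_triangle (hχ : IsPQColoring n 4 5 χ) (hn : 4 ≤ n) {b x y : Fin n}
    (hxb : x ≠ b) (hyb : y ≠ b) (hxy : x ≠ y) (h : χ b x = χ b y) (h' : χ b x = χ x y) :
    False := by
  obtain ⟨z, hz⟩ := Finset.exists_mem_notMem_of_card_lt_card
    (Finset.card_le_three.trans_lt (by rw [Finset.card_univ, Fintype.card_fin]; omega) :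
      ({b, x, y} : Finset (Fin n)).card < (Finset.univ : Finset (Fin n)).card)
  simp only [Finset.mem_insert, Finset.mem_singleton, not_or] at hz
  obtain ⟨-, hzb, hzx, hzy⟩ := hz
  refine hχ.not_subset hxb.symm hyb.symm (Ne.symm hzb) hxy (Ne.symm hzx) (Ne.symm hzy)
    (L := {χ b x, χ b z, χ x z, χ y z}) Finset.card_le_four ?_ ?_ ?_ ?_ ?_ ?_ <;> simp [← h, ← h']

theorem IsPQColoring.not_path (hχ : IsPQColoring n 4 5 χ) (hn : 4 ≤ n) {b x y z : Fin n}
    (hxb : x ≠ b) (hyb : y ≠ b) (hxy : x ≠ y) (hzx : z ≠ x) (hzb : z ≠ b) (h : χ b x = χ b y)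
    (h' : χ x b = χ x z) : False := by
  rw [hχ.1 x b] at h'
  by_cases hyz : y = z
  · subst hyz
    exact hχ.not_triangle hn hxb hyb hxy h h'
  · refine hχ.not_subset hxb.symm hyb.symm hzb.symm hxy hzx.symm hyz
      (L := {χ b x, χ x y, χ b z, χ y z}) Finset.card_le_four ?_ ?_ ?_ ?_ ?_ ?_ <;>
      simp [← h, ← h']

theorem IsPQColoring.not_arm_eq_base (hχ : IsPQColoring n 4 5 χ) (hn : 4 ≤ n) {b x y z : Fin n}
    (hxb : x ≠ b) (hyb : y ≠ b) (hxy : x ≠ y) (hzx : z ≠ x) (hzb : z ≠ b) (h : χ b x = χ b y)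
    (h' : χ z b = χ z x) : False := by
  by_cases hyz : y = z
  · subst hyz
    exact hχ.not_triangle hn hxb hyb hxy h (by rw [h, hχ.1 b, h', hχ.1])
  · refine hχ.not_subset hxb.symm hyb.symm hzb.symm hxy hzx.symm hyz
      (L := {χ b x, χ x y, χ b z, χ y z}) Finset.card_le_four ?_ ?_ ?_ ?_ ?_ ?_ <;>
      simp [← h, hχ.1 x z, ← h', hχ.1 z b]

/-- The ordered monochromatic paths `x - b - y`, recorded as `(b, x, y)`. -/
def monoPaths (χ : Fin n → Fin n → ℕ) : Finset (Fin n × Fin n × Fin n) :=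
  Finset.univ.filter fun t =>
    t.2.1 ≠ t.1 ∧ t.2.2 ≠ t.1 ∧ t.2.1 ≠ t.2.2 ∧ χ t.1 t.2.1 = χ t.1 t.2.2

theorem IsPQColoring.three_mul_card_monoPaths_le (hχ : IsPQColoring n 4 5 χ) (hn : 4 ≤ n) :
    3 * (monoPaths χ).card ≤ (Finset.univ : Finset (Fin n)).offDiag.card := by
  set S := monoPaths χ with hS
  have mem : ∀ {b x y}, (b, x, y) ∈ S ↔ x ≠ b ∧ y ≠ b ∧ x ≠ y ∧ χ b x = χ b y := by
    simp [hS, monoPaths]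
  let F₁ := S.image fun t => (t.1, t.2.1)
  let F₂ := S.image fun t => (t.2.1, t.1)
  let F₃ := S.image fun t => (t.2.1, t.2.2)
  have c₁ : F₁.card = S.card := Finset.card_image_of_injOn (by
    rintro ⟨b, x, y⟩ ht ⟨b', x', y'⟩ ht' e
    obtain ⟨rfl, rfl⟩ := Prod.ext_iff.1 e
    obtain ⟨h1, h2, h3, h4⟩ := mem.1 ht
    obtain ⟨g1, g2, g3, g4⟩ := mem.1 ht'
    dsimp only at *
    rw [hχ.eq_of_star h1 h2 g2 h3 g3 h4 g4])
  have c₂ : F₂.card = S.card := Finset.card_image_of_injOn (by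
    rintro ⟨b, x, y⟩ ht ⟨b', x', y'⟩ ht' e
    obtain ⟨rfl, rfl⟩ := Prod.ext_iff.1 e
    obtain ⟨h1, h2, h3, h4⟩ := mem.1 ht
    obtain ⟨g1, g2, g3, g4⟩ := mem.1 ht'
    dsimp only at *
    rw [hχ.eq_of_star h1 h2 g2 h3 g3 h4 g4])
  have c₃ : F₃.card = S.card := Finset.card_image_of_injOn (by
    rintro ⟨b, x, y⟩ ht ⟨b', x', y'⟩ ht' e
    obtain ⟨rfl, rfl⟩ := Prod.ext_iff.1 e
    obtain ⟨h1, h2, h3, h4⟩ := mem.1 ht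
    obtain ⟨g1, g2, g3, g4⟩ := mem.1 ht'
    dsimp only at *
    rw [hχ.eq_of_common_base h1 h2 g1 g2 h3 h4 g4])
  have d₁₂ : Disjoint F₁ F₂ := by
    rw [Finset.disjoint_left]
    intro u hu hu'
    obtain ⟨⟨b, x, y⟩, ht, rfl⟩ := Finset.mem_image.1 hu
    obtain ⟨⟨b', x', y'⟩, ht', e⟩ := Finset.mem_image.1 hu'
    obtain ⟨rfl, rfl⟩ := Prod.ext_iff.1 e
    obtain ⟨h1, h2, h3, h4⟩ := mem.1 ht
    obtain ⟨g1, g2, g3, g4⟩ := mem.1 ht'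
    exact hχ.not_path hn h1 h2 h3 g2 g3.symm h4 g4
  have d₃ : Disjoint (F₁ ∪ F₂) F₃ := by
    rw [Finset.disjoint_union_left, Finset.disjoint_left, Finset.disjoint_left]
    constructor
    · intro u hu hu'
      obtain ⟨⟨b, x, y⟩, ht, rfl⟩ := Finset.mem_image.1 hu
      obtain ⟨⟨b', x', y'⟩, ht', e⟩ := Finset.mem_image.1 hu'
      obtain ⟨rfl, rfl⟩ := Prod.ext_iff.1 e
      obtain ⟨h1, h2, h3, h4⟩ := mem.1 ht
      obtain ⟨g1, g2, g3, g4⟩ := mem.1 ht'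
      exact hχ.not_arm_eq_base hn h1 h2 h3 g2.symm g1.symm h4 g4
    · intro u hu hu'
      obtain ⟨⟨b, x, y⟩, ht, rfl⟩ := Finset.mem_image.1 hu
      obtain ⟨⟨b', x', y'⟩, ht', e⟩ := Finset.mem_image.1 hu'
      obtain ⟨rfl, rfl⟩ := Prod.ext_iff.1 e
      obtain ⟨h1, h2, h3, h4⟩ := mem.1 ht
      obtain ⟨g1, g2, g3, g4⟩ := mem.1 ht'
      exact hχ.not_arm_eq_base hn h1 h2 h3 g1.symm g2.symm h4 g4.symm
  have hsub : F₁ ∪ F₂ ∪ F₃ ⊆ (Finset.univ : Finset (Fin n)).offDiag := by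
    intro u hu
    simp only [F₁, F₂, F₃, Finset.mem_union, Finset.mem_image] at hu
    rw [Finset.mem_offDiag]
    rcases hu with (⟨⟨b, x, y⟩, ht, rfl⟩ | ⟨⟨b, x, y⟩, ht, rfl⟩) | ⟨⟨b, x, y⟩, ht, rfl⟩ <;>
      obtain ⟨h1, h2, h3, h4⟩ := mem.1 ht
    · exact ⟨Finset.mem_univ _, Finset.mem_univ _, h1.symm⟩
    · exact ⟨Finset.mem_univ _, Finset.mem_univ _, h1⟩
    · exact ⟨Finset.mem_univ _, Finset.mem_univ _, h3⟩
  have h := Finset.card_le_card hsub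
  rw [Finset.card_union_of_disjoint d₃, Finset.card_union_of_disjoint d₁₂, c₁, c₂, c₃] at h
  omega

theorem two_mul_card_offDiag_le (χ : Fin n → Fin n → ℕ) :
    2 * (Finset.univ : Finset (Fin n)).offDiag.card ≤
      2 * (n * (usedColors χ).card) + (monoPaths χ).card := by
  set D := (Finset.univ : Finset (Fin n)).offDiag
  let P : Finset (Fin n × ℕ) := Finset.univ ×ˢ usedColors χ
  have used : ∀ {b x : Fin n}, b ≠ x → χ b x ∈ usedColors χ := fun {b x} h =>
    Finset.mem_image.2 ⟨(b, x), by simpa using h, rfl⟩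
  have hD : D.card = ∑ e ∈ P, (D.filter fun u => (u.1, χ u.1 u.2) = e).card :=
    Finset.card_eq_sum_card_fiberwise fun u hu => by
      simpa [P] using used (Finset.mem_offDiag.1 hu).2.2
  have hS : (monoPaths χ).card =
      ∑ e ∈ P, ((monoPaths χ).filter fun t => (t.1, χ t.1 t.2.1) = e).card :=
    Finset.card_eq_sum_card_fiberwise fun t ht => by
      simpa [P] using used (Finset.mem_filter.1 ht).2.1.symm
  have hP : n * (usedColors χ).card = ∑ e ∈ P, 1 := by simp [P]
  rw [hD, hS, hP, Finset.mul_sum, Finset.mul_sum, ← Finset.sum_add_distrib]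
  refine Finset.sum_le_sum fun e _ => ?_
  have h : (D.filter fun u => (u.1, χ u.1 u.2) = e).offDiag.card ≤
      ((monoPaths χ).filter fun t => (t.1, χ t.1 t.2.1) = e).card := by
    refine Finset.card_le_card_of_injOn (fun v => (v.1.1, v.1.2, v.2.2)) ?_ ?_
    · rintro ⟨⟨b, x⟩, ⟨b', y⟩⟩ hv
      simp only [Finset.coe_offDiag, Set.mem_offDiag, Finset.mem_coe, Finset.mem_filter, D,
        Finset.mem_offDiag, monoPaths, Finset.mem_univ, true_and] at hv ⊢
      grind
    · rintro ⟨⟨b, x⟩, ⟨b', y⟩⟩ hv ⟨⟨c, z⟩, ⟨c', w⟩⟩ hw he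
      simp only [Finset.coe_offDiag, Set.mem_offDiag, Finset.mem_coe, Finset.mem_filter] at hv hw
      grind
  rw [Finset.offDiag_card] at h
  set f := (D.filter fun u => (u.1, χ u.1 u.2) = e).card
  have : 2 * f ≤ 2 + (f * f - f) := by
    rcases f with _ | _ | f
    · simp
    · simp
    · have : (f + 1 + 1) * (f + 1 + 1) - (f + 1 + 1) = f * f + 3 * f + 2 := by
        rw [Nat.sub_eq_iff_eq_add (by nlinarith)]; ring
      nlinarith
  omega

theorem IsPQColoring.five_mul_le (hχ : IsPQColoring n 4 5 χ) (hn : 4 ≤ n) :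
    5 * n ≤ 6 * (usedColors χ).card + 5 := by
  have h1 := hχ.three_mul_card_monoPaths_le hn
  have h2 := two_mul_card_offDiag_le χ
  obtain ⟨k, rfl⟩ : ∃ k, n = k + 1 := ⟨n - 1, by omega⟩
  have h3 : (Finset.univ : Finset (Fin (k + 1))).offDiag.card = (k + 1) * k := by
    rw [Finset.offDiag_card, Finset.card_univ, Fintype.card_fin, Nat.mul_succ,
      Nat.add_sub_cancel]
  rw [h3] at h1 h2
  have h4 : (k + 1) * (5 * k) ≤ (k + 1) * (6 * (usedColors χ).card) := by nlinarith
  have := Nat.le_of_mul_le_mul_left h4 (by omega)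
  omega

end LowerBound

section UpperBound

theorem IsWeakColoring.comp {V W α β : Type*} {c : V → V → α} (hc : IsWeakColoring c)
    {φ : W → V} (hφ : φ.Injective) {g : α → β} (hg : g.Injective) :
    IsWeakColoring fun i j => g (c (φ i) (φ j)) where
  symm _ _ := congrArg g (hc.symm _ _)
  center h1 h2 h3 h4 h5 h6 := (hc.center (hφ.ne h1) (hφ.ne h2) (hφ.ne h3) (hg h4) (hφ.ne h5)
    (hg h6)).imp (@hφ _ _) (@hφ _ _)
  leaf h1 h2 h3 h4 h5 h6 :=
    hφ (hc.leaf (hφ.ne h1) (hφ.ne h2) (hφ.ne h3) (hg h4) (hφ.ne h5) (hg h6))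
  base h1 h2 h3 h4 h5 h6 :=
    hφ (hc.base (hφ.ne h1) (hφ.ne h2) (hφ.ne h3) (hg h4) (hφ.ne h5) (hg h6))
  avoid h1 h2 h3 h4 h5 :=
    hg.ne (hc.avoid (hφ.ne h1) (hφ.ne h2) (hφ.ne h3) (hg h4) (hφ.ne h5))
  unique h1 h2 h3 h4 h5 h6 h7 := hφ (hc.unique (hφ.ne h1) (hφ.ne h2) (hφ.ne h3) (hg h4)
    (hφ.ne h5) (hφ.ne h6) (hg h7))

theorem NoAlternatingCycle.comp {V W α β : Type*} {c : V → V → α} (hc : NoAlternatingCycle c)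
    {φ : W → V} (hφ : φ.Injective) {g : α → β} (hg : g.Injective) :
    NoAlternatingCycle fun i j => g (c (φ i) (φ j)) :=
  fun _ _ _ _ h1 h2 h3 h4 h5 h6 h7 => hg.ne (hc _ _ _ _ (hφ.ne h1) (hφ.ne h2) (hφ.ne h3)
    (hφ.ne h4) (hφ.ne h5) (hφ.ne h6) (hg h7))

theorem IsWeakColoring.isPQColoring {n : ℕ} {χ : Fin n → Fin n → ℕ} (hc : IsWeakColoring χ)
    (hn : NoAlternatingCycle χ) : IsPQColoring n 4 5 χ := by
  refine ⟨hc.symm, fun S hS => ?_⟩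
  obtain ⟨p, q, r, s, hpq, hpr, hps, hqr, hqs, hrs, rfl⟩ := Finset.card_eq_four.1 hS
  refine hc.five_le_card hn hpq hpr hps hqr hqs hrs fun u v hu hv huv => ?_
  exact Finset.mem_image.2 ⟨(u, v), by simpa [huv] using And.intro hu hv, rfl⟩

theorem IsPQColoring.erdosGyarfas_le {n p q : ℕ} {χ : Fin n → Fin n → ℕ}
    (hχ : IsPQColoring n p q χ) : erdosGyarfas n p q ≤ (usedColors χ).card :=
  Nat.sInf_le ⟨χ, hχ, rfl⟩

theorem IsPQColoring.exists_erdosGyarfas {n p q : ℕ} {χ : Fin n → Fin n → ℕ}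
    (hχ : IsPQColoring n p q χ) :
    ∃ χ' : Fin n → Fin n → ℕ, IsPQColoring n p q χ' ∧
      (usedColors χ').card = erdosGyarfas n p q :=
  Nat.sInf_mem (s := {m : ℕ | ∃ χ : Fin n → Fin n → ℕ, IsPQColoring n p q χ ∧
    (usedColors χ).card = m}) ⟨_, χ, hχ, rfl⟩

theorem IsWeakColoring.exists_isPQColoring {V α : Type*} [Fintype V] [Countable α]
    {c : V → V → α} (hc : IsWeakColoring c) (hn : NoAlternatingCycle c) {A : Finset α}
    (hA : ∀ x y, x ≠ y → c x y ∈ A) {n : ℕ} (hV : n ≤ Fintype.card V) :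
    ∃ χ : Fin n → Fin n → ℕ, IsPQColoring n 4 5 χ ∧ (usedColors χ).card ≤ A.card := by
  classical
  obtain ⟨g, hg⟩ := Countable.exists_injective_nat α
  obtain ⟨φ⟩ := Function.Embedding.nonempty_of_card_le
    (α := Fin n) (β := V) (by rwa [Fintype.card_fin])
  refine ⟨_, (hc.comp φ.injective hg).isPQColoring (hn.comp φ.injective hg), ?_⟩
  refine (Finset.card_le_card (t := A.image g) ?_).trans Finset.card_image_le
  intro κ hκ
  obtain ⟨⟨i, j⟩, hij, rfl⟩ := Finset.mem_image.1 hκ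
  exact Finset.mem_image_of_mem _ (hA _ _ (φ.injective.ne (by simpa using hij)))

/-- For a suitable exponent `K` and modulus step `L`, the lifted ternary coloring of
`3 ^ (d + 2) * (1 + t * L) ^ K` vertices is a `(4, 5)`-coloring. -/
theorem exists_isPQColoring_of_le (d : ℕ) :
    ∃ K L : ℕ, K ≠ 0 ∧ 0 < L ∧ ∀ t n : ℕ, 0 < t → n ≤ 3 ^ (d + 2) * (1 + t * L) ^ K →
      ∃ χ : Fin n → Fin n → ℕ, IsPQColoring n 4 5 χ ∧
        6 * (usedColors χ).card ≤ (30 + 5 * 3 ^ (d + 2)) * (1 + t * L) ^ K := by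
  obtain ⟨J, _, L, hL, hlift⟩ := exists_liftData ((Fin (d + 1) → ZMod 3) × ZMod 3)
  obtain ⟨A, hA, hcard⟩ := exists_ternaryColor_palette (ι := Fin (d + 1))
  classical
  obtain ⟨f₀, C₀, hf₀⟩ := hlift 0
  have : Nonempty J := ⟨hf₀.sidon.choose⟩
  refine ⟨Fintype.card J, L, Fintype.card_ne_zero, hL, fun t n ht hn => ?_⟩
  obtain ⟨f, C, hf⟩ := hlift t
  have : Fact (1 < 1 + t * L) := ⟨by have := Nat.mul_pos ht hL; omega⟩
  have : NeZero (1 + t * L) := ⟨by omega⟩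
  have hc := isWeakColoring_ternaryColor (ι := Fin (d + 1))
  obtain ⟨χ, hχ, hle⟩ := (hf.isWeakColoring hc).exists_isPQColoring
    (hf.noAlternatingCycle (c := ternaryColor))
    (A := (A ×ˢ Finset.univ).disjSum Finset.univ) (n := n) (by
      intro p q _
      unfold liftColor
      split_ifs with h1 h2
      · simp
      · simp
      · simpa using hA _ _ h1)
    (by simpa [ZMod.card, pow_succ] using hn)
  refine ⟨χ, hχ, ?_⟩
  simp only [Finset.card_disjSum, Finset.card_product, Finset.card_univ, Fintype.card_sum,
    Fintype.card_fun, ZMod.card, Fintype.card_fin] at hle hcard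
  have h := Nat.mul_le_mul_right ((1 + t * L) ^ Fintype.card J) hcard
  rw [pow_succ 3 (d + 1)]
  nlinarith

end UpperBound

theorem exists_ratio_pow_le (K L : ℕ) {η : ℝ} (hη : 0 < η) :
    ∃ t₀ : ℕ, ∀ t, t₀ ≤ t →
      ((1 + (t + 1 : ℕ) * L : ℕ) : ℝ) ^ K ≤ (1 + η) * ((1 + t * L : ℕ) : ℝ) ^ K := by
  have h : Filter.Tendsto (fun t : ℕ => (1 + 1 / (t : ℝ)) ^ K) Filter.atTop (nhds 1) := by
    simpa using (tendsto_one_div_atTop_nhds_zero_nat.const_add (1 : ℝ)).pow K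
  obtain ⟨t₀, ht₀⟩ := Filter.eventually_atTop.1
    (h.eventually (ge_mem_nhds (lt_add_of_pos_right 1 hη)))
  refine ⟨t₀ + 1, fun t ht => ?_⟩
  have htpos : (0 : ℝ) < t := by exact_mod_cast (by omega : 0 < t)
  calc ((1 + (t + 1 : ℕ) * L : ℕ) : ℝ) ^ K
      ≤ ((1 + 1 / (t : ℝ)) * ((1 + t * L : ℕ) : ℝ)) ^ K := by
        gcongr
        push_cast
        have : (1 + 1 / (t : ℝ)) * (1 + t * L) = 1 + t * L + L + 1 / t := by field_simp; ring
        rw [this]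
        have : 0 < 1 / (t : ℝ) := by positivity
        linarith
    _ = (1 + 1 / (t : ℝ)) ^ K * ((1 + t * L : ℕ) : ℝ) ^ K := mul_pow _ _ _
    _ ≤ _ := by gcongr; exact ht₀ t (by omega)

theorem exists_isPQColoring_card_le {ε : ℝ} (hε : 0 < ε) :
    ∃ N : ℕ, ∀ n, N ≤ n → ∃ χ : Fin n → Fin n → ℕ, IsPQColoring n 4 5 χ ∧
      ((usedColors χ).card : ℝ) ≤ (5 / 6 + ε) * n := by
  obtain ⟨d, hd⟩ := pow_unbounded_of_one_lt (10 / ε) (by norm_num : (1 : ℝ) < 3)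
  obtain ⟨K, L, hK, hL, hcol⟩ := exists_isPQColoring_of_le d
  obtain ⟨t₀, ht₀⟩ := exists_ratio_pow_le K L (η := ε / 6) (by positivity)
  set m : ℕ := 3 ^ (d + 2) with hm
  refine ⟨m * (1 + t₀ * L) ^ K + 1, fun n hn => ?_⟩
  have hex : ∃ t, n ≤ m * (1 + t * L) ^ K := ⟨n, calc
    n ≤ 1 + n * L := (Nat.le_mul_of_pos_right n hL).trans (Nat.le_add_left _ _)
    _ ≤ (1 + n * L) ^ K := Nat.le_self_pow hK _
    _ ≤ _ := Nat.le_mul_of_pos_left _ (by positivity)⟩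
  have hlt : t₀ < Nat.find hex := by
    by_contra! h
    have : m * (1 + Nat.find hex * L) ^ K ≤ m * (1 + t₀ * L) ^ K := by gcongr
    have := Nat.find_spec hex
    omega
  obtain ⟨s, hs⟩ : ∃ s, Nat.find hex = s + 1 := ⟨Nat.find hex - 1, by omega⟩
  have hspec := Nat.find_spec hex
  have hmin := Nat.find_min hex (m := s) (by omega)
  rw [hs] at hspec
  obtain ⟨χ, hχ, hle⟩ := hcol (s + 1) n (by omega) hspec
  refine ⟨χ, hχ, ?_⟩
  have hratio := ht₀ s (by omega)
  set Q : ℝ := ((1 + s * L : ℕ) : ℝ) ^ K with hQ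
  have hle' : 6 * ((usedColors χ).card : ℝ) ≤
      (30 + 5 * m) * ((1 + (s + 1 : ℕ) * L : ℕ) : ℝ) ^ K := by exact_mod_cast hle
  have hn' : m * Q ≤ n := by rw [hQ]; exact_mod_cast (not_le.1 hmin).le
  have hm9 : (9 : ℝ) ≤ m := by
    have : 1 ≤ 3 ^ d := Nat.one_le_pow _ _ (by norm_num)
    exact_mod_cast (by rw [hm, pow_add]; omega : 9 ≤ m)
  have hmε : 30 ≤ ε * m := by
    rw [div_lt_iff₀ hε] at hd
    have : (m : ℝ) = 3 ^ d * 9 := by rw [hm, pow_add]; norm_num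
    rw [this]
    linarith
  have hQ0 : 0 ≤ Q := by positivity
  have hcoef : (30 + 5 * m) * (1 + ε / 6) ≤ (5 + 6 * ε) * (m : ℝ) := by nlinarith
  have := calc 6 * ((usedColors χ).card : ℝ)
      ≤ (30 + 5 * m) * ((1 + ε / 6) * Q) := hle'.trans (by gcongr)
    _ = ((30 + 5 * m) * (1 + ε / 6)) * Q := by ring
    _ ≤ ((5 + 6 * ε) * m) * Q := by gcongr
    _ = (5 + 6 * ε) * (m * Q) := by ring
    _ ≤ (5 + 6 * ε) * n := by gcongr
  linarith

theorem erdosGyarfas_four_five_asymptotics :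
    ∀ ε : ℝ, 0 < ε → ∃ N : ℕ, ∀ n : ℕ, N ≤ n →
      |(erdosGyarfas n 4 5 : ℝ) - (5 / 6 : ℝ) * (n : ℝ)| ≤ ε * (n : ℝ) := by
  intro ε hε
  obtain ⟨N, hN⟩ := exists_isPQColoring_card_le hε
  obtain ⟨M, hM⟩ := exists_nat_ge (1 / ε)
  refine ⟨max N (max M 4), fun n hn => ?_⟩
  obtain ⟨χ, hχ, hle⟩ := hN n (by omega)
  obtain ⟨χ', hχ', heq⟩ := hχ.exists_erdosGyarfas
  have hlow := hχ'.five_mul_le (by omega)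
  rw [heq] at hlow
  have hlow' : (5 : ℝ) * n ≤ 6 * erdosGyarfas n 4 5 + 5 := by exact_mod_cast hlow
  have hup : (erdosGyarfas n 4 5 : ℝ) ≤ (usedColors χ).card := by
    exact_mod_cast hχ.erdosGyarfas_le
  have hεn : 1 ≤ ε * n := by
    rw [mul_comm, ← div_le_iff₀ hε]
    exact hM.trans (by exact_mod_cast (by omega : M ≤ n))
  rw [abs_le]
  constructor <;> linarith
end

section
/- For every ε > 0 there exists N such that for all n ≥ N, f(n, 4, 5) ≤ (5/6 + ε)·n; that is, for all sufficiently large n there exists an edge-coloring of K_n with at most (5/6 + ε)n colors in which every 4-element vertex set spans at least 5 distinct colors. -/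
section Coincidences

/-- An edge coloring in which no four vertices carry two coincidences between edge colors. -/
structure IsGood {V C : Type*} (f : V → V → C) : Prop where
  symm : ∀ a b, f a b = f b a
  star : ∀ a b c d, a ≠ b → a ≠ c → a ≠ d → b ≠ c → b ≠ d → c ≠ d →
    f a b = f a c → f a b ≠ f a d
  triangle : ∀ a b c, a ≠ b → a ≠ c → b ≠ c → f a b = f b c → f b c ≠ f c a
  path : ∀ a b c d, a ≠ b → a ≠ c → a ≠ d → b ≠ c → b ≠ d → c ≠ d →
    f a b = f b c → f b c ≠ f c d
  twoPaths : ∀ a b c d, a ≠ b → a ≠ c → a ≠ d → b ≠ c → b ≠ d → c ≠ d →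
    f a b = f b c → f c d ≠ f d a
  closing : ∀ a b c d, a ≠ b → a ≠ c → a ≠ d → b ≠ c → b ≠ d → c ≠ d →
    f a b = f b c → f c a ≠ f c d
  opposite : ∀ a b c d, a ≠ b → a ≠ c → a ≠ d → b ≠ c → b ≠ d → c ≠ d →
    f a b = f b c → f a c ≠ f b d
  alternating : ∀ a b c d, a ≠ b → a ≠ c → a ≠ d → b ≠ c → b ≠ d → c ≠ d →
    f a b = f c d → f b c ≠ f d a

theorem five_le_card_of_distinct_s2 {C : Type*} {T : Finset C} {x₁ x₂ x₃ x₄ x₅ : C}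
    (h₁ : x₁ ∈ T) (h₂ : x₂ ∈ T) (h₃ : x₃ ∈ T) (h₄ : x₄ ∈ T) (h₅ : x₅ ∈ T)
    (h₁₂ : x₁ ≠ x₂) (h₁₃ : x₁ ≠ x₃) (h₁₄ : x₁ ≠ x₄) (h₁₅ : x₁ ≠ x₅) (h₂₃ : x₂ ≠ x₃)
    (h₂₄ : x₂ ≠ x₄) (h₂₅ : x₂ ≠ x₅) (h₃₄ : x₃ ≠ x₄) (h₃₅ : x₃ ≠ x₅) (h₄₅ : x₄ ≠ x₅) :
    5 ≤ T.card := by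
  classical
  have hsub : ({x₁, x₂, x₃, x₄, x₅} : Finset C) ⊆ T := by
    intro x hx
    simp only [Finset.mem_insert, Finset.mem_singleton] at hx
    rcases hx with rfl | rfl | rfl | rfl | rfl <;> assumption
  have hcard : ({x₁, x₂, x₃, x₄, x₅} : Finset C).card = 5 := by
    simp [*]
  exact hcard ▸ Finset.card_le_card hsub

theorem exists_fourth {V : Type*} {S : Finset V} (hS : S.card = 4) {a b c : V} :
    ∃ d ∈ S, d ≠ a ∧ d ≠ b ∧ d ≠ c := by
  classical
  have h : ({a, b, c} : Finset V).card < S.card := by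
    have := Finset.card_le_three (a := a) (b := b) (c := c)
    omega
  obtain ⟨d, hd, hd'⟩ := Finset.exists_mem_notMem_of_card_lt_card h
  simp only [Finset.mem_insert, Finset.mem_singleton, not_or] at hd'
  exact ⟨d, hd, hd'⟩

theorem IsGood.five_le_card {V C : Type*} {f : V → V → C} (hf : IsGood f) {S : Finset V}
    (hS : S.card = 4) {T : Finset C} (hT : ∀ a ∈ S, ∀ b ∈ S, a ≠ b → f a b ∈ T) :
    5 ≤ T.card := by
  have s := hf.symm
  by_cases hP : ∃ a ∈ S, ∃ b ∈ S, ∃ c ∈ S, a ≠ b ∧ a ≠ c ∧ b ≠ c ∧ f a b = f a c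
  · obtain ⟨a, ha, b, hb, c, hc, hab, hac, hbc, h⟩ := hP
    obtain ⟨d, hd, hda, hdb, hdc⟩ := exists_fourth hS (a := a) (b := b) (c := c)
    refine five_le_card_of_distinct_s2 (hT a ha b hb hab) (hT a ha d hd hda.symm)
      (hT b hb c hc hbc) (hT b hb d hd hdb.symm) (hT c hc d hd hdc.symm)
      ?_ ?_ ?_ ?_ ?_ ?_ ?_ ?_ ?_ ?_ <;> intro e
    · exact hf.star a b c d hab hac hda.symm hbc hdb.symm hdc.symm h e
    · exact hf.triangle b a c hab.symm hbc hac (by rw [s b a, h])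
        (by rw [← h, e, s b c])
    · exact hf.path c a b d hac.symm hbc.symm hdc.symm hab hda.symm hdb.symm
        (by rw [s c a, h]) e
    · exact hf.path b a c d hab.symm hbc hdb.symm hac hda.symm hdc.symm
        (by rw [s b a, h]) (by rw [← h, e])
    · exact hf.opposite b a c d hab.symm hbc hdb.symm hac hda.symm hdc.symm
        (by rw [s b a, h]) e.symm
    · exact hf.closing b d a c hdb.symm hab.symm hbc hda hdc hac
        (by rw [← e, s a d]) h
    · exact hf.closing c d a b hdc.symm hac.symm hbc.symm hda hdb hab
        (by rw [← e, s a d]) h.symm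
    · exact hf.closing c a b d hac.symm hbc.symm hdc.symm hab hda.symm hdb.symm
        (by rw [s c a, h]) e
    · exact hf.closing b a c d hab.symm hbc hdb.symm hac hda.symm hdc.symm
        (by rw [s b a, h]) (by rw [s c b, e])
    · exact hf.twoPaths b a c d hab.symm hbc hdb.symm hac hda.symm hdc.symm
        (by rw [s b a, h]) (by rw [← e, s b d])
  push Not at hP
  have hadj : ∀ {a b c}, a ∈ S → b ∈ S → c ∈ S → a ≠ b → a ≠ c → b ≠ c → f a b ≠ f a c :=
    fun ha hb hc => hP _ ha _ hb _ hc
  have key : ∀ {a b c d}, a ∈ S → b ∈ S → c ∈ S → d ∈ S → a ≠ b → a ≠ c → a ≠ d → b ≠ c →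
      b ≠ d → c ≠ d → f a c ≠ f b d → f a d ≠ f b c → 5 ≤ T.card := by
    intro a b c d ha hb hc hd hab hac had hbc hbd hcd h₁ h₂
    refine five_le_card_of_distinct_s2 (hT a ha b hb hab) (hT a ha c hc hac)
      (hT a ha d hd had) (hT b hb c hc hbc) (hT b hb d hd hbd)
      (hadj ha hb hc hab hac hbc) (hadj ha hb hd hab had hbd) ?_ ?_
      (hadj ha hc hd hac had hcd) ?_ h₁ h₂ ?_ (hadj hb hc hd hbc hbd hcd)
    · rw [s a b]; exact hadj hb ha hc hab.symm hbc hac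
    · rw [s a b]; exact hadj hb ha hd hab.symm hbd had
    · rw [s a c, s b c]; exact hadj hc ha hb hac.symm hbc.symm hab
    · rw [s a d, s b d]; exact hadj hd ha hb had.symm hbd.symm hab
  obtain ⟨a, ha⟩ : S.Nonempty := Finset.card_pos.mp (by omega)
  obtain ⟨b, hb, hba, -, -⟩ := exists_fourth hS (a := a) (b := a) (c := a)
  obtain ⟨c, hc, hca, hcb, -⟩ := exists_fourth hS (a := a) (b := b) (c := b)
  obtain ⟨d, hd, hda, hdb, hdc⟩ := exists_fourth hS (a := a) (b := b) (c := c)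
  by_cases h₁ : f a c = f b d
  · refine key ha hc hb hd hca.symm hba.symm hda.symm hcb hdc.symm hdb.symm
      (fun e => hf.alternating a c d b hca.symm hda.symm hba.symm hdc.symm hcb hdb
        (by rw [h₁, s b d]) (by rw [← e, s a b])) fun e =>
      hf.alternating a c b d hca.symm hba.symm hda.symm hcb hdc.symm hdb.symm h₁
        (by rw [← e, s a d])
  by_cases h₂ : f a d = f b c
  · refine key ha hd hb hc hda.symm hba.symm hca.symm hdb hdc hcb.symm
      (fun e => hf.alternating a d c b hda.symm hca.symm hba.symm hdc hdb hcb
        (by rw [h₂, s b c]) (by rw [← e, s a b])) fun e =>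
      hf.alternating a d b c hda.symm hba.symm hca.symm hdb hdc hcb.symm h₂
        (by rw [← e, s a c])
  exact key ha hb hc hd hba.symm hca.symm hda.symm hcb.symm hdb.symm hdc.symm h₁ h₂

theorem erdosGyarfas_le_of_isGood {V C : Type*} [Fintype V] [Fintype C] {f : V → V → C}
    (hf : IsGood f) {n : ℕ} (hn : n ≤ Fintype.card V) :
    erdosGyarfas n 4 5 ≤ Fintype.card C := by
  classical
  obtain ⟨ι⟩ : Nonempty (Fin n ↪ V) :=
    Function.Embedding.nonempty_of_card_le (by simpa using hn)
  let e := Fintype.equivFin C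
  let χ : Fin n → Fin n → ℕ := fun i j => (e (f (ι i) (ι j))).val
  have hχ : IsPQColoring n 4 5 χ := by
    refine ⟨fun i j => by simp only [χ, hf.symm (ι i) (ι j)], fun S hS => ?_⟩
    have hcard : (S.map ι).card = 4 := by rw [Finset.card_map, hS]
    have h5 : 5 ≤ ((spannedColors χ S).preimage (fun x => (e x).val)
        (Function.Injective.injOn (Fin.val_injective.comp e.injective))).card := by
      refine hf.five_le_card hcard ?_
      intro a ha b hb hab
      obtain ⟨i, hi, rfl⟩ := Finset.mem_map.mp ha
      obtain ⟨j, hj, rfl⟩ := Finset.mem_map.mp hb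
      rw [Finset.mem_preimage, spannedColors, Finset.mem_image]
      refine ⟨(i, j), ?_, rfl⟩
      simp only [Finset.mem_filter, Finset.mem_product]
      exact ⟨⟨hi, hj⟩, fun h => hab (congrArg ι h)⟩
    refine h5.trans ?_
    rw [Finset.card_preimage]
    exact Finset.card_le_card (Finset.filter_subset _ _)
  have hle : erdosGyarfas n 4 5 ≤ (usedColors χ).card := Nat.sInf_le ⟨χ, hχ, rfl⟩
  refine hle.trans ?_
  have hsub : usedColors χ ⊆ Finset.range (Fintype.card C) := by
    intro x hx
    rw [usedColors, Finset.mem_image] at hx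
    obtain ⟨p, -, rfl⟩ := hx
    exact Finset.mem_range.mpr (e _).isLt
  simpa using Finset.card_le_card hsub

end Coincidences

section BlowUp

/-- Weights allowing a coloring indexed by `X` to be blown up along the ring `R`. -/
structure IsWeight {X R : Type*} [CommRing R] (w : X → X → R) : Prop where
  isUnit : ∀ x y, x ≠ y → IsUnit (w x y)
  isUnit_sub : ∀ x y z, x ≠ y → x ≠ z → y ≠ z → IsUnit (w x y - w x z)
  isUnit_add : ∀ x y z, x ≠ y → x ≠ z → y ≠ z → IsUnit (w x y + w x z)
  double : ∀ x y, x ≠ y → w x y = 2 * w y x ∨ w y x = 2 * w x y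

/-- The blow-up of a coloring: every vertex `x` is replaced by a copy of `R`. -/
def blowUp {X C R K : Type*} [DecidableEq X] [CommRing R] (f : X → X → C) (w : X → X → R)
    (cl : R → K) (A B : X × R) : (C ⊕ K) × R :=
  if A.1 = B.1 then (Sum.inr (cl (A.2 - B.2)), A.2 + B.2)
  else (Sum.inl (f A.1 B.1), w A.1 B.1 * A.2 + w B.1 A.1 * B.2)

variable {X C R K : Type*} [DecidableEq X] [CommRing R] {f : X → X → C} {w : X → X → R}
  {cl : R → K}

theorem blowUp_eq_cross {A B A' B' : X × R} (hAB : A.1 ≠ B.1)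
    (h : blowUp f w cl A B = blowUp f w cl A' B') :
    A'.1 ≠ B'.1 ∧ f A.1 B.1 = f A'.1 B'.1 ∧
      w A.1 B.1 * A.2 + w B.1 A.1 * B.2 = w A'.1 B'.1 * A'.2 + w B'.1 A'.1 * B'.2 := by
  unfold blowUp at h
  rw [if_neg hAB] at h
  split_ifs at h with h'
  · simp at h
  · exact ⟨h', by simpa using h⟩

theorem blowUp_eq_inside {A B A' B' : X × R} (hAB : A.1 = B.1)
    (h : blowUp f w cl A B = blowUp f w cl A' B') :
    A'.1 = B'.1 ∧ cl (A.2 - B.2) = cl (A'.2 - B'.2) ∧ A.2 + B.2 = A'.2 + B'.2 := by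
  unfold blowUp at h
  rw [if_pos hAB] at h
  split_ifs at h with h'
  · exact ⟨h', by simpa using h⟩
  · simp at h

theorem blowUp_symm (hf : ∀ a b, f a b = f b a) (hcl : ∀ d, cl (-d) = cl d) (A B : X × R) :
    blowUp f w cl A B = blowUp f w cl B A := by
  unfold blowUp
  by_cases h : A.1 = B.1
  · rw [if_pos h, if_pos h.symm, ← hcl, neg_sub, add_comm]
  · rw [if_neg h, if_neg (Ne.symm h), hf, add_comm]

theorem blowUp_path (hw : IsWeight w) {A B D : X × R} (hBD : B ≠ D)
    (h : blowUp f w cl A B = blowUp f w cl A D) :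
    A.1 ≠ B.1 ∧ A.1 ≠ D.1 ∧ B.1 ≠ D.1 ∧ f A.1 B.1 = f A.1 D.1 ∧
      w A.1 B.1 * A.2 + w B.1 A.1 * B.2 = w A.1 D.1 * A.2 + w D.1 A.1 * D.2 := by
  by_cases hAB : A.1 = B.1
  · obtain ⟨h₁, -, h₂⟩ := blowUp_eq_inside hAB h
    exact absurd (Prod.ext (hAB.symm.trans h₁) (add_left_cancel h₂)) hBD
  · obtain ⟨h₁, h₂, h₃⟩ := blowUp_eq_cross hAB h
    refine ⟨hAB, h₁, fun e => hBD (Prod.ext e ?_), h₂, h₃⟩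
    rw [e] at h₃
    exact (hw.isUnit _ _ (Ne.symm h₁)).mul_left_cancel (add_left_cancel h₃)

/-- Two edges inside two different parts do not alternate with two edges between these parts. -/
theorem blowUp_alternating_inside (hw : IsWeight w) (h2 : IsUnit (2 : R))
    (hcl2 : ∀ d, d ≠ 0 → cl (2 * d) ≠ cl d) {A B D E : X × R}
    (hAB : A ≠ B) (hAD : A ≠ D) (h : A.1 = B.1)
    (h₁ : blowUp f w cl A B = blowUp f w cl D E) (h₂ : blowUp f w cl B D = blowUp f w cl E A) :
    False := by
  obtain ⟨hDE, hc, hs⟩ := blowUp_eq_inside h h₁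
  by_cases hBD : B.1 = D.1
  · obtain ⟨-, -, hs'⟩ := blowUp_eq_inside hBD h₂
    refine hAD (Prod.ext (h.trans hBD) (h2.mul_left_cancel ?_))
    linear_combination hs - hs'
  · obtain ⟨-, -, hs'⟩ := blowUp_eq_cross hBD h₂
    rw [← hDE, h] at hs'
    have hne : A.2 - B.2 ≠ 0 := fun e => hAB (Prod.ext h (sub_eq_zero.mp e))
    have hlin : w B.1 D.1 * (A.2 - B.2) = w D.1 B.1 * (D.2 - E.2) := by
      linear_combination -hs'
    rcases hw.double _ _ hBD with e | e
    · rw [e, mul_comm 2, mul_assoc] at hlin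
      have := (hw.isUnit _ _ (Ne.symm hBD)).mul_left_cancel hlin
      rw [← this] at hc
      exact hcl2 _ hne hc.symm
    · rw [e, mul_comm 2, mul_assoc] at hlin
      have := (hw.isUnit _ _ hBD).mul_left_cancel hlin
      rw [this] at hc hne
      exact hcl2 _ (fun e' => hne (by rw [e', mul_zero])) hc

theorem blowUp_alternating_return (hw : IsWeight w) (h2 : IsUnit (2 : R))
    {A B D E : X × R} (hAD : A ≠ D) (hBE : B ≠ E) (hABx : A.1 ≠ B.1) (h : A.1 = D.1)
    (h₁ : blowUp f w cl A B = blowUp f w cl D E) (h₂ : blowUp f w cl B D = blowUp f w cl E A) :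
    False := by
  obtain ⟨-, -, hs⟩ := blowUp_eq_cross hABx h₁
  obtain ⟨hEA, -, hs'⟩ := blowUp_eq_cross (fun e => hABx (h.trans e.symm)) h₂
  rw [h] at hs hs' hABx hEA
  by_cases hB : B.1 = E.1
  · rw [hB] at hs hs'
    refine hBE (Prod.ext hB ((hw.isUnit _ _ hEA).mul_left_cancel (h2.mul_left_cancel ?_)))
    linear_combination hs + hs'
  · refine hAD (Prod.ext h ?_)
    refine (hw.isUnit_add D.1 B.1 E.1 hABx (Ne.symm hEA) hB).mul_left_cancel ?_
    linear_combination hs - hs'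

theorem IsGood.blowUp (hf : IsGood f) (hw : IsWeight w) (h2 : IsUnit (2 : R))
    (hcl : ∀ d, cl (-d) = cl d) (hcl2 : ∀ d, d ≠ 0 → cl (2 * d) ≠ cl d) :
    IsGood (blowUp f w cl) := by
  have s := hf.symm
  have S : ∀ A B, _root_.blowUp f w cl A B = _root_.blowUp f w cl B A := blowUp_symm s hcl
  have P : ∀ {A B D : X × R}, A ≠ D → _root_.blowUp f w cl A B = _root_.blowUp f w cl B D →
      B.1 ≠ A.1 ∧ B.1 ≠ D.1 ∧ A.1 ≠ D.1 ∧ f A.1 B.1 = f B.1 D.1 ∧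
      w B.1 A.1 * B.2 + w A.1 B.1 * A.2 = w B.1 D.1 * B.2 + w D.1 B.1 * D.2 := by
    intro A B D hAD h
    rw [S A B] at h
    obtain ⟨h₁, h₂, h₃, h₄, h₅⟩ := blowUp_path hw hAD h
    exact ⟨h₁, h₂, h₃, by rw [s A.1, h₄], h₅⟩
  refine ⟨S, ?_, ?_, ?_, ?_, ?_, ?_, ?_⟩
  · intro A B D E hAB hAD hAE hBD hBE hDE h h'
    obtain ⟨h₁, h₂, h₃, h₄, -⟩ := blowUp_path hw hBD h
    obtain ⟨-, h₅, h₆, h₇, -⟩ := blowUp_path hw hBE h'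
    obtain ⟨-, -, h₈, -, -⟩ := blowUp_path hw hDE (h.symm.trans h')
    exact hf.star _ _ _ _ h₁ h₂ h₅ h₃ h₆ h₈ h₄ h₇
  · intro A B D hAB hAD hBD h h'
    obtain ⟨h₁, h₂, h₃, h₄, -⟩ := P hAD h
    obtain ⟨-, -, -, h₅, -⟩ := P hAB.symm h'
    exact hf.triangle _ _ _ h₁.symm h₃ h₂ h₄ h₅
  · intro A B D E hAB hAD hAE hBD hBE hDE h h'
    obtain ⟨h₁, h₂, h₃, h₄, -⟩ := P hAD h
    obtain ⟨-, h₅, h₆, h₇, -⟩ := P hBE h'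
    by_cases e : A.1 = E.1
    · exact hf.triangle _ _ _ h₁.symm h₃ h₂ h₄ (e ▸ h₇)
    · exact hf.path _ _ _ _ h₁.symm h₃ e h₂ h₆ h₅ h₄ h₇
  · intro A B D E hAB hAD hAE hBD hBE hDE h h'
    obtain ⟨h₁, h₂, h₃, h₄, h₅⟩ := P hAD h
    obtain ⟨h₆, h₇, -, h₈, h₉⟩ := P hAD.symm h'
    by_cases e : B.1 = E.1
    · rw [← e] at h₉
      refine hBE (Prod.ext e ((hw.isUnit_sub _ _ _ h₁ h₂ h₃).mul_left_cancel ?_))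
      linear_combination h₅ + h₉
    · exact hf.twoPaths _ _ _ _ h₁.symm h₃ h₇.symm h₂ e h₆.symm h₄ h₈
  · intro A B D E hAB hAD hAE hBD hBE hDE h h'
    obtain ⟨h₁, h₂, h₃, h₄, -⟩ := P hAD h
    obtain ⟨-, h₅, h₆, h₇, -⟩ := blowUp_path hw hAE h'
    by_cases e : B.1 = E.1
    · exact hf.triangle _ _ _ h₁.symm h₃ h₂ h₄ (by rw [s B.1, h₇, e])
    · exact hf.closing _ _ _ _ h₁.symm h₃ h₆ h₂ e h₅ h₄ h₇
  · intro A B D E hAB hAD hAE hBD hBE hDE h h'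
    obtain ⟨h₁, h₂, h₃, h₄, -⟩ := P hAD h
    obtain ⟨h₅, h₆, -⟩ := blowUp_eq_cross h₃ h'
    by_cases e : A.1 = E.1
    · exact hf.triangle _ _ _ h₁.symm h₃ h₂ h₄ (by rw [s D.1, h₆, ← e, ← h₄, s])
    by_cases e' : D.1 = E.1
    · exact hf.triangle _ _ _ h₁.symm h₃ h₂ h₄ (by rw [s D.1, h₆, ← e'])
    · exact hf.opposite _ _ _ _ h₁.symm h₃ e h₂ h₅ e' h₄ h₆
  · intro A B D E hAB hAD hAE hBD hBE hDE h h'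
    have h'' : _root_.blowUp f w cl D E = _root_.blowUp f w cl A B := h.symm
    by_cases e₁ : A.1 = B.1
    · exact blowUp_alternating_inside hw h2 hcl2 hAB hAD e₁ h h'
    by_cases e₂ : B.1 = D.1
    · exact blowUp_alternating_inside hw h2 hcl2 hBD hBE e₂ h' h''
    by_cases e₃ : A.1 = D.1
    · exact blowUp_alternating_return hw h2 hAD hBE e₁ e₃ h h'
    by_cases e₄ : B.1 = E.1
    · exact blowUp_alternating_return hw h2 hBE hAD.symm e₂ e₄ h' h''
    obtain ⟨h₁, h₂, -⟩ := blowUp_eq_cross e₁ h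
    obtain ⟨h₃, h₄, -⟩ := blowUp_eq_cross e₂ h'
    exact hf.alternating _ _ _ _ e₁ e₃ (Ne.symm h₃) e₂ e₄ h₁ h₂ h₄

end BlowUp

section Weights

/-- A coloring of `ZMod r`, invariant under negation, separating `d` from `2 * d`. -/
def dyadicClass (r : ℕ) (d : ZMod r) : Fin 3 :=
  if r < 3 * d.valMinAbs.natAbs then 2
  else if Nat.log 2 d.valMinAbs.natAbs % 2 = 0 then 0 else 1

theorem dyadicClass_neg (r : ℕ) (d : ZMod r) : dyadicClass r (-d) = dyadicClass r d := by
  unfold dyadicClass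
  rw [ZMod.natAbs_valMinAbs_neg]

theorem dyadicClass_two_mul_ne {r : ℕ} (h2 : r % 2 = 1) (h3 : r % 3 ≠ 0) {d : ZMod r}
    (hd : d ≠ 0) : dyadicClass r (2 * d) ≠ dyadicClass r d := by
  have : NeZero r := ⟨by rintro rfl; simp at h2⟩
  obtain ⟨hlo, hhi⟩ := d.valMinAbs_mem_Ioc
  have hcoe : ((d.valMinAbs : ℤ) : ZMod r) = d := d.coe_valMinAbs
  have ha : d.valMinAbs ≠ 0 := fun h => hd (by rw [← hcoe, h, Int.cast_zero])
  generalize hA : d.valMinAbs = a at *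
  have spec : ∀ b : ℤ, ((b : ℤ) : ZMod r) = 2 * d → -(r : ℤ) < b * 2 → b * 2 ≤ r →
      (2 * d).valMinAbs = b := fun b h h' h'' =>
    (ZMod.valMinAbs_spec _ _).mpr ⟨h.symm, h', h''⟩
  have hcase : (2 * d).valMinAbs.natAbs = 2 * a.natAbs ∧ 4 * a.natAbs < r ∨
      (2 * d).valMinAbs.natAbs = r - 2 * a.natAbs ∧ r < 4 * a.natAbs := by
    by_cases h4 : 4 * a.natAbs < r
    · left
      rw [spec (2 * a) (by push_cast; rw [hcoe]) (by omega) (by omega)]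
      omega
    · right
      rcases lt_or_gt_of_ne ha with h | h
      · rw [spec (2 * a + r) (by push_cast; rw [hcoe]; simp) (by omega) (by omega)]
        omega
      · rw [spec (2 * a - r) (by push_cast; rw [hcoe]; simp) (by omega) (by omega)]
        omega
  unfold dyadicClass
  rw [hA]
  have hpos : a.natAbs ≠ 0 := by omega
  generalize a.natAbs = n at *
  rcases hcase with ⟨h, h'⟩ | ⟨h, h'⟩
  · have hlog : Nat.log 2 (2 * n) = Nat.log 2 n + 1 := by
      rw [mul_comm, Nat.log_mul_base (by norm_num) hpos]
    rw [h, hlog]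
    split_ifs <;> omega
  · rw [h]
    split_ifs <;> omega

theorem isUnit_intCast_of_coprime {r M : ℕ} (hr : ∀ t, 0 < t → t ≤ M → Nat.Coprime t r) {t : ℤ}
    (h0 : t ≠ 0) (ht : t.natAbs ≤ M) : IsUnit ((t : ℤ) : ZMod r) := by
  have h : IsUnit ((t.natAbs : ℕ) : ZMod r) :=
    (ZMod.isUnit_iff_coprime _ _).mpr (hr _ (Int.natAbs_pos.mpr h0) ht)
  rcases Int.natAbs_eq t with e | e <;> rw [e]
  · rwa [Int.cast_natCast]
  · rw [Int.cast_neg, Int.cast_natCast]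
    exact h.neg

/-- The weight of the part with label `a` in the edges towards the part with label `b`. -/
def integerWeight (m a b : ℕ) : ℤ := (if a < b then 1 else 2) * (6 * m + a + b)

theorem isWeight_integerWeight {X : Type*} {m r : ℕ} {ν : X → ℕ} (hν : Function.Injective ν)
    (hm : ∀ x, ν x < m) (hr : ∀ t, 0 < t → t ≤ 32 * m → Nat.Coprime t r) :
    IsWeight fun x y => ((integerWeight m (ν x) (ν y) : ℤ) : ZMod r) := by
  have hne : ∀ {x y}, x ≠ y → ν x ≠ ν y := fun h h' => h (hν h')
  refine ⟨fun x y hxy => ?_, fun x y z hxy hxz hyz => ?_, fun x y z hxy hxz hyz => ?_,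
    fun x y hxy => ?_⟩
  · have := hm x; have := hm y
    refine isUnit_intCast_of_coprime hr ?_ ?_ <;> unfold integerWeight <;> split_ifs <;> omega
  · have := hm x; have := hm y; have := hm z; have := hne hyz
    rw [← Int.cast_sub]
    refine isUnit_intCast_of_coprime hr ?_ ?_ <;> unfold integerWeight <;> split_ifs <;> omega
  · have := hm x; have := hm y; have := hm z
    rw [← Int.cast_add]
    refine isUnit_intCast_of_coprime hr ?_ ?_ <;> unfold integerWeight <;> split_ifs <;> omega
  · unfold integerWeight
    rcases lt_or_gt_of_ne (hne hxy) with h | h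
    · right
      rw [if_pos h, if_neg (by omega)]
      push_cast
      ring
    · left
      rw [if_pos h, if_neg (by omega)]
      push_cast
      ring

theorem IsGood.erdosGyarfas_blowUp_le {X C : Type*} [Fintype X] [Fintype C] {f : X → X → C}
    (hf : IsGood f) {r n : ℕ} (hX : 2 ≤ Fintype.card X)
    (hr : ∀ t, 0 < t → t ≤ 32 * Fintype.card X → Nat.Coprime t r) (hr0 : r ≠ 0)
    (hn : n ≤ Fintype.card X * r) :
    erdosGyarfas n 4 5 ≤ (Fintype.card C + 3) * r := by
  classical
  have : NeZero r := ⟨hr0⟩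
  have h2 : r % 2 = 1 :=
    Nat.odd_iff.mp (Nat.Coprime.odd_of_left (hr 2 (by norm_num) (by omega)))
  have h3 : r % 3 ≠ 0 := fun h => by
    have h' := hr 3 (by norm_num) (by omega)
    have := Nat.Coprime.eq_one_of_dvd h' (Nat.dvd_of_mod_eq_zero h)
    omega
  let e := Fintype.equivFin X
  have hw : IsWeight fun x y =>
      ((integerWeight (Fintype.card X) (e x).val (e y).val : ℤ) : ZMod r) :=
    isWeight_integerWeight (ν := fun x => (e x).val) (Fin.val_injective.comp e.injective)
      (fun x => (e x).isLt) hr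
  have h2' : IsUnit (2 : ZMod r) := by
    have := isUnit_intCast_of_coprime hr (t := 2) (by norm_num) (by simp; omega)
    exact_mod_cast this
  have hgood := hf.blowUp hw h2' (dyadicClass_neg r) fun d => dyadicClass_two_mul_ne h2 h3
  have := erdosGyarfas_le_of_isGood hgood (n := n)
    (by rw [Fintype.card_prod, ZMod.card]; exact hn)
  simpa [Fintype.card_prod, Fintype.card_sum, ZMod.card] using this

end Weights

section Template

/-- The template: `(κ, ρ)` at index `12 s + 2 t + σ` describes the edges from type `s` to type `t`
whose difference is a square (`σ = 1`) or a nonsquare (`σ = 0`). -/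
def templateTable : List (Fin 5 × ZMod 23) :=
  [(0, 16), (0, 8), (4, 14), (1, 4), (0, 10), (4, 5), (1, 3), (3, 18), (2, 4), (1, 20), (3, 8), (2, 3),
   (1, 20), (4, 10), (1, 6), (1, 18), (3, 21), (2, 14), (0, 19), (2, 6), (0, 16), (3, 11), (4, 10), (4, 2),
   (4, 19), (0, 14), (2, 10), (3, 3), (3, 5), (3, 19), (4, 2), (0, 2), (4, 16), (2, 5), (1, 8), (1, 18),
   (3, 6), (1, 21), (2, 18), (0, 5), (0, 22), (4, 22), (2, 5), (2, 19), (3, 11), (4, 12), (3, 9), (1, 12),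
   (1, 4), (2, 20), (3, 13), (0, 8), (2, 19), (4, 8), (4, 12), (3, 13), (0, 6), (0, 18), (2, 13), (1, 4),
   (2, 21), (3, 16), (4, 22), (4, 14), (1, 6), (1, 16), (1, 12), (3, 15), (1, 20), (2, 11), (0, 17), (0, 7)]

def template (s t : Fin 6) (σ : Bool) : Fin 5 × ZMod 23 :=
  templateTable.getD (12 * s.val + 2 * t.val + σ.toNat) (0, 0)

/-- Whether a nonzero residue modulo `23` is a square. -/
def residue (a : ZMod 23) : Bool := Nat.testBit 340830 a.val

/-- The colour class together with the sign of the offset of the colour from its endpoint. -/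
def slot (s t : Fin 6) (σ : Bool) : Fin 5 × Bool :=
  ((template s t σ).1, σ == residue (template s t σ).2)

/-- The sign of the edge closing a monochromatic path centred at type `s`. -/
def closingSign (s a b : Fin 6) (σ τ : Bool) : Bool :=
  (σ == residue (template s b τ).2) == residue ((template s a σ).2 - (template s b τ).2)

theorem template_ne_zero : ∀ s t σ, (template s t σ).2 ≠ 0 := by decide +kernel

theorem template_swap : ∀ s t σ,
    template t s (!σ) = ((template s t σ).1, 1 - (template s t σ).2) := by decide +kernel

theorem residue_iff_isSquare : ∀ a : ZMod 23, a ≠ 0 → (residue a = true ↔ IsSquare a) := by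
  decide +kernel

theorem slot_star : ∀ s a b : Fin 6, ∀ σ τ : Bool, slot s a σ = slot s b τ →
    (a, σ) ≠ (b, τ) → ∀ c υ, slot s a σ = slot s c υ → (a, σ) = (c, υ) ∨ (b, τ) = (c, υ) := by
  decide +kernel

theorem slot_path : ∀ s a b : Fin 6, ∀ σ τ : Bool, slot s a σ = slot s b τ →
    (a, σ) ≠ (b, τ) → ∀ c υ, slot b s (!τ) = slot b c υ → (s, !τ) = (c, υ) := by
  decide +kernel

theorem slot_closing : ∀ s a b : Fin 6, ∀ σ τ : Bool, slot s a σ = slot s b τ →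
    (a, σ) ≠ (b, τ) → (template s a σ).2 ≠ (template s b τ).2 ∧
      (template a b (closingSign s a b σ τ)).2 * ((template s a σ).2 - (template s b τ).2) =
        -(template s b τ).2 := by
  decide +kernel

theorem slot_closing_single : ∀ s a b : Fin 6, ∀ σ τ : Bool, slot s a σ = slot s b τ →
    (a, σ) ≠ (b, τ) → ∀ c υ, slot b a (!closingSign s a b σ τ) = slot b c υ →
      (a, !closingSign s a b σ τ) = (c, υ) := by
  decide +kernel

theorem slot_center_unique : ∀ s a b : Fin 6, ∀ σ τ : Bool, slot s a σ = slot s b τ →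
    (a, σ) ≠ (b, τ) → ∀ s', slot s' a σ = slot s' b τ → s = s' := by
  decide +kernel

theorem template_self_ne : ∀ s t : Fin 6, ∀ σ : Bool, s ≠ t →
    template s s σ ≠ template t t σ := by
  decide +kernel

theorem template_ne_swap : ∀ s t : Fin 6, ∀ σ : Bool, s ≠ t →
    template s t σ ≠ template t s σ := by
  decide +kernel

def altX (ρ₂ ρ₃ ρ₄ : ZMod 23) : ZMod 23 := -ρ₄ - ρ₃ * (ρ₂ - ρ₄)

def altY (ρ₁ ρ₃ ρ₄ : ZMod 23) : ZMod 23 := ρ₃ * (1 - ρ₄) + (1 - ρ₁) * ρ₄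

def altZ (ρ₁ ρ₂ ρ₄ : ZMod 23) : ZMod 23 := (1 - ρ₁) * (ρ₂ - ρ₄) - (1 - ρ₄)

/-- Consecutive differences proportional to `(x, y, z)` with the given signs close up to an
alternating four-cycle only in a degenerate way. -/
def NoAlternation (a b c d : Fin 6) (σ₁ σ₂ σ₃ σ₄ : Bool) (x y z : ZMod 23) : Prop :=
  (x ≠ 0 ∨ y ≠ 0 ∨ z ≠ 0) ∧
  (x ≠ 0 → y ≠ 0 → z ≠ 0 → x + y + z ≠ 0 → (σ₁ == residue x) = (σ₂ == residue y) →
    (σ₁ == residue x) = (σ₃ == residue z) → (σ₁ == residue x) = (σ₄ == residue (x + y + z)) →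
    (a = c ∧ x + y = 0) ∨ (b = d ∧ y + z = 0))

instance (a b c d : Fin 6) (σ₁ σ₂ σ₃ σ₄ : Bool) (x y z : ZMod 23) :
    Decidable (NoAlternation a b c d σ₁ σ₂ σ₃ σ₄ x y z) := by
  unfold NoAlternation
  infer_instance

theorem template_noAlternation : ∀ a b c d : Fin 6, ∀ σ₁ σ₂ σ₃ σ₄ : Bool,
    (template a b σ₁).1 = (template c d σ₃).1 → (template b c σ₂).1 = (template a d σ₄).1 →
    NoAlternation a b c d σ₁ σ₂ σ₃ σ₄
      (altX (template b c σ₂).2 (template c d σ₃).2 (template a d σ₄).2)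
      (altY (template a b σ₁).2 (template c d σ₃).2 (template a d σ₄).2)
      (altZ (template a b σ₁).2 (template b c σ₂).2 (template a d σ₄).2) := by
  decide +kernel

end Template

section TemplateColoring

instance fact_prime_twentyThree : Fact (Nat.Prime 23) := ⟨by norm_num⟩

/-- A sign function on a field `F` extending the quadratic character of `ZMod 23`. -/
structure IsSign {F : Type*} [Field F] (ι : ZMod 23 →+* F) (sg : F → Bool) : Prop where
  mul : ∀ x y, x ≠ 0 → y ≠ 0 → sg (x * y) = (sg x == sg y)
  neg : ∀ x, x ≠ 0 → sg (-x) = !sg x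
  map : ∀ a, a ≠ 0 → sg (ι a) = residue a

variable {F : Type*} [Field F] {ι : ZMod 23 →+* F} {sg : F → Bool}

theorem IsSign.sub_swap (hs : IsSign ι sg) {x y : F} (h : x ≠ y) : sg (x - y) = !sg (y - x) := by
  rw [← neg_sub, hs.neg _ (sub_ne_zero.mpr h.symm)]

theorem map_template_ne_zero (ι : ZMod 23 →+* F) (s t : Fin 6) (σ : Bool) :
    ι (template s t σ).2 ≠ 0 :=
  (map_ne_zero ι).mpr (template_ne_zero s t σ)

variable [DecidableEq F]

/-- The coloring of `Fin 6 × F` described by the template. -/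
def templateColoring (ι : ZMod 23 →+* F) (sg : F → Bool) (A B : Fin 6 × F) :
    (Fin 5 × F) ⊕ Sym2 (Fin 6) :=
  if A.2 = B.2 then Sum.inr s(A.1, B.1)
  else Sum.inl ((template A.1 B.1 (sg (B.2 - A.2))).1,
    A.2 + ι (template A.1 B.1 (sg (B.2 - A.2))).2 * (B.2 - A.2))

theorem templateColoring_eq_vertical {A B A' B' : Fin 6 × F} (hAB : A.2 = B.2)
    (h : templateColoring ι sg A B = templateColoring ι sg A' B') :
    A'.2 = B'.2 ∧ s(A.1, B.1) = s(A'.1, B'.1) := by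
  unfold templateColoring at h
  rw [if_pos hAB] at h
  split_ifs at h with h'
  exact ⟨h', Sum.inr_injective h⟩

theorem templateColoring_eq_inl {A B A' B' : Fin 6 × F} (hAB : A.2 ≠ B.2)
    (h : templateColoring ι sg A B = templateColoring ι sg A' B') :
    A'.2 ≠ B'.2 ∧
      (template A.1 B.1 (sg (B.2 - A.2))).1 = (template A'.1 B'.1 (sg (B'.2 - A'.2))).1 ∧
      A.2 + ι (template A.1 B.1 (sg (B.2 - A.2))).2 * (B.2 - A.2) =
        A'.2 + ι (template A'.1 B'.1 (sg (B'.2 - A'.2))).2 * (B'.2 - A'.2) := by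
  unfold templateColoring at h
  rw [if_neg hAB] at h
  split_ifs at h with h'
  exact ⟨h', Prod.ext_iff.mp (Sum.inl_injective h)⟩

theorem templateColoring_symm (hs : IsSign ι sg) (A B : Fin 6 × F) :
    templateColoring ι sg A B = templateColoring ι sg B A := by
  unfold templateColoring
  by_cases h : A.2 = B.2
  · rw [if_pos h, if_pos h.symm, Sym2.eq_swap]
  · rw [if_neg h, if_neg (Ne.symm h), hs.sub_swap h, template_swap]
    congr 2
    rw [map_sub, map_one]
    ring

theorem templateColoring_path (hs : IsSign ι sg) {A B D : Fin 6 × F} (hBD : B ≠ D)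
    (h : templateColoring ι sg A B = templateColoring ι sg A D) :
    A.2 ≠ B.2 ∧ A.2 ≠ D.2 ∧
      slot A.1 B.1 (sg (B.2 - A.2)) = slot A.1 D.1 (sg (D.2 - A.2)) ∧
      (B.1, sg (B.2 - A.2)) ≠ (D.1, sg (D.2 - A.2)) ∧
      ι (template A.1 B.1 (sg (B.2 - A.2))).2 * (B.2 - A.2) =
        ι (template A.1 D.1 (sg (D.2 - A.2))).2 * (D.2 - A.2) := by
  by_cases hAB : A.2 = B.2
  · obtain ⟨hAD, h'⟩ := templateColoring_eq_vertical hAB h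
    exact absurd (Prod.ext (Sym2.congr_right.mp h') (hAB.symm.trans hAD)) hBD
  obtain ⟨hAD, hκ, hρ⟩ := templateColoring_eq_inl hAB h
  have hρ' := add_left_cancel hρ
  have hB : B.2 - A.2 ≠ 0 := sub_ne_zero.mpr (Ne.symm hAB)
  have hD : D.2 - A.2 ≠ 0 := sub_ne_zero.mpr (Ne.symm hAD)
  refine ⟨hAB, hAD, ?_, fun e => ?_, hρ'⟩
  · have hsg := congrArg sg hρ'
    rw [hs.mul _ _ (map_template_ne_zero _ _ _ _) hB, hs.mul _ _ (map_template_ne_zero _ _ _ _) hD,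
      hs.map _ (template_ne_zero _ _ _), hs.map _ (template_ne_zero _ _ _)] at hsg
    unfold slot
    rw [hκ, Bool.beq_comm, hsg, Bool.beq_comm]
  · obtain ⟨e₁, e₂⟩ := Prod.ext_iff.mp e
    simp only at e₁ e₂
    rw [e₁, e₂] at hρ'
    exact hBD (Prod.ext e₁ (sub_left_injective (mul_left_cancel₀ (map_template_ne_zero _ _ _ _) hρ')))

theorem templateColoring_closing (hs : IsSign ι sg) {A B D : Fin 6 × F} (hBD : B ≠ D)
    (h : templateColoring ι sg A B = templateColoring ι sg A D) :
    B.2 ≠ D.2 ∧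
      sg (D.2 - B.2) = closingSign A.1 B.1 D.1 (sg (B.2 - A.2)) (sg (D.2 - A.2)) ∧
      B.2 + ι (template B.1 D.1 (sg (D.2 - B.2))).2 * (D.2 - B.2) = A.2 := by
  obtain ⟨hAB, hAD, hslot, hne, hρ⟩ := templateColoring_path hs hBD h
  obtain ⟨h₁, h₂⟩ := slot_closing _ _ _ _ _ hslot hne
  have hB : B.2 - A.2 ≠ 0 := sub_ne_zero.mpr (Ne.symm hAB)
  set ρ := template A.1 B.1 (sg (B.2 - A.2)) with hρdef
  set ρ' := template A.1 D.1 (sg (D.2 - A.2)) with hρdef'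
  have hρ'0 : ι ρ'.2 ≠ 0 := map_template_ne_zero _ _ _ _
  have hdiff : ι ρ'.2 * (D.2 - B.2) = (B.2 - A.2) * ι (ρ.2 - ρ'.2) := by
    rw [map_sub]
    linear_combination -hρ
  have h₁' : ι (ρ.2 - ρ'.2) ≠ 0 := (map_ne_zero ι).mpr (sub_ne_zero.mpr h₁)
  have hDB : D.2 - B.2 ≠ 0 := fun e => by
    rw [e, mul_zero] at hdiff
    exact mul_ne_zero hB h₁' hdiff.symm
  have hsg : sg (D.2 - B.2) = closingSign A.1 B.1 D.1 (sg (B.2 - A.2)) (sg (D.2 - A.2)) := by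
    have := congrArg sg hdiff
    rw [hs.mul _ _ hρ'0 hDB, hs.mul _ _ hB h₁', hs.map _ (template_ne_zero _ _ _),
      hs.map _ (sub_ne_zero.mpr h₁)] at this
    unfold closingSign
    rw [← hρdef, ← hρdef']
    revert this
    generalize sg (D.2 - B.2) = x₁, residue ρ'.2 = x₂, residue (ρ.2 - ρ'.2) = x₃,
      sg (B.2 - A.2) = x₄
    revert x₁ x₂ x₃ x₄
    decide
  refine ⟨fun e => hDB (sub_eq_zero.mpr e.symm), hsg, ?_⟩
  rw [← hsg] at h₂
  have h₃ := congrArg ι h₂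
  rw [map_mul, map_neg] at h₃
  refine mul_left_cancel₀ hρ'0 ?_
  linear_combination ι (template B.1 D.1 (sg (D.2 - B.2))).2 * hdiff + (B.2 - A.2) * h₃

theorem templateColoring_alternating_vertical {A B D E : Fin 6 × F}
    (hs : IsSign ι sg) (hAB : A ≠ B) (hAD : A ≠ D) (hAE : A ≠ E) (h : A.2 = B.2)
    (h₁ : templateColoring ι sg A B = templateColoring ι sg D E)
    (h₂ : templateColoring ι sg B D = templateColoring ι sg E A) : False := by
  obtain ⟨hDE, hAB'⟩ := templateColoring_eq_vertical h h₁
  have hne : A.1 ≠ B.1 := fun e => hAB (Prod.ext e h)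
  rw [templateColoring_symm hs E A] at h₂
  rcases Sym2.eq_iff.mp hAB' with ⟨e₁, e₂⟩ | ⟨e₁, e₂⟩
  · have hBD : B.2 ≠ D.2 := fun e => hAD (Prod.ext e₁ (h.trans e))
    obtain ⟨-, hκ, hρ⟩ := templateColoring_eq_inl hBD h₂
    rw [← e₁, ← e₂, h, ← hDE] at hκ hρ
    have := mul_right_cancel₀ (sub_ne_zero.mpr (Ne.symm hBD)) (add_left_cancel hρ)
    exact template_ne_swap _ _ _ hne.symm (Prod.ext hκ (ι.injective this))
  · have hBD : B.2 ≠ D.2 := fun e => hAE (Prod.ext e₁ (h.trans (e.trans hDE)))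
    obtain ⟨-, hκ, hρ⟩ := templateColoring_eq_inl hBD h₂
    rw [← e₁, ← e₂, h, ← hDE] at hκ hρ
    have := mul_right_cancel₀ (sub_ne_zero.mpr (Ne.symm hBD)) (add_left_cancel hρ)
    exact template_self_ne _ _ _ hne.symm (Prod.ext hκ (ι.injective this))

theorem templateColoring_alternating_cross {A B D E : Fin 6 × F}
    (hs : IsSign ι sg) (hAD : A ≠ D) (hBE : B ≠ E) (hAB : A.2 ≠ B.2) (hBD : B.2 ≠ D.2)
    (h₁ : templateColoring ι sg A B = templateColoring ι sg D E)
    (h₂ : templateColoring ι sg B D = templateColoring ι sg E A) : False := by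
  rw [templateColoring_symm hs E A] at h₂
  obtain ⟨hDE, hκ₁, hρ₁⟩ := templateColoring_eq_inl hAB h₁
  obtain ⟨hAE, hκ₂, hρ₂⟩ := templateColoring_eq_inl hBD h₂
  obtain ⟨hn, hno⟩ := template_noAlternation _ _ _ _ _ _ _ _ hκ₁ hκ₂
  set ρ₁ := (template A.1 B.1 (sg (B.2 - A.2))).2
  set ρ₂ := (template B.1 D.1 (sg (D.2 - B.2))).2
  set ρ₃ := (template D.1 E.1 (sg (E.2 - D.2))).2
  set ρ₄ := (template A.1 E.1 (sg (E.2 - A.2))).2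
  set x := altX ρ₂ ρ₃ ρ₄ with hx
  set y := altY ρ₁ ρ₃ ρ₄ with hy
  set z := altZ ρ₁ ρ₂ ρ₄ with hz
  have hx' : ι x = -ι ρ₄ - ι ρ₃ * (ι ρ₂ - ι ρ₄) := by simp [hx, altX]
  have hy' : ι y = ι ρ₃ * (1 - ι ρ₄) + (1 - ι ρ₁) * ι ρ₄ := by simp [hy, altY]
  have hz' : ι z = (1 - ι ρ₁) * (ι ρ₂ - ι ρ₄) - (1 - ι ρ₄) := by simp [hz, altZ]
  have hxy : (B.2 - A.2) * ι y = (D.2 - B.2) * ι x := by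
    rw [hx', hy']
    linear_combination ι ρ₃ * hρ₂ - ι ρ₄ * hρ₁
  have hxz : (B.2 - A.2) * ι z = (E.2 - D.2) * ι x := by
    rw [hx', hz']
    linear_combination -(ι ρ₂ - ι ρ₄) * hρ₁ - hρ₂
  have hyz : (D.2 - B.2) * ι z = (E.2 - D.2) * ι y := by
    rw [hy', hz']
    linear_combination (1 - ι ρ₁) * hρ₂ + (1 - ι ρ₄) * hρ₁
  have hxt : (B.2 - A.2) * ι (x + y + z) = (E.2 - A.2) * ι x := by
    rw [map_add, map_add]
    linear_combination hxy + hxz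
  have d₁ : B.2 - A.2 ≠ 0 := sub_ne_zero.mpr (Ne.symm hAB)
  have d₂ : D.2 - B.2 ≠ 0 := sub_ne_zero.mpr (Ne.symm hBD)
  have d₃ : E.2 - D.2 ≠ 0 := sub_ne_zero.mpr (Ne.symm hDE)
  have d₄ : E.2 - A.2 ≠ 0 := sub_ne_zero.mpr (Ne.symm hAE)
  have transfer : ∀ {u v : F} {a b : ZMod 23}, u ≠ 0 → u * ι a = v * ι b → b = 0 → a = 0 := by
    intro u v a b hu h hb
    rw [hb, map_zero, mul_zero] at h
    exact (map_eq_zero ι).mp ((mul_eq_zero.mp h).resolve_left hu)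
  have hx0 : x ≠ 0 := fun e => by
    rcases hn with h | h | h
    exacts [h e, h (transfer d₁ hxy e), h (transfer d₁ hxz e)]
  have hy0 : y ≠ 0 := fun e => hx0 (transfer d₂ hxy.symm e)
  have hz0 : z ≠ 0 := fun e => hx0 (transfer d₃ hxz.symm e)
  have ht0 : x + y + z ≠ 0 := fun e => hx0 (transfer d₄ hxt.symm e)
  have sign : ∀ {u v : F} {a b : ZMod 23}, u ≠ 0 → v ≠ 0 → a ≠ 0 → b ≠ 0 →
      u * ι a = v * ι b → (sg u == residue b) = (sg v == residue a) := by
    intro u v a b hu hv ha hb h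
    have h := congrArg sg h
    rw [hs.mul _ _ hu ((map_ne_zero ι).mpr ha), hs.mul _ _ hv ((map_ne_zero ι).mpr hb),
      hs.map _ ha, hs.map _ hb] at h
    revert h
    generalize sg u = x₁, sg v = x₂, residue a = x₃, residue b = x₄
    revert x₁ x₂ x₃ x₄
    decide
  rcases hno hx0 hy0 hz0 ht0 (sign d₁ d₂ hy0 hx0 hxy) (sign d₁ d₃ hz0 hx0 hxz)
    (sign d₁ d₄ ht0 hx0 hxt) with ⟨e, h⟩ | ⟨e, h⟩
  · have h' : ι x + ι y = 0 := by rw [← map_add, h, map_zero]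
    have : (D.2 - A.2) * ι x = 0 := by linear_combination (B.2 - A.2) * h' - hxy
    have := (mul_eq_zero.mp this).resolve_right ((map_ne_zero ι).mpr hx0)
    exact hAD (Prod.ext e (sub_eq_zero.mp this).symm)
  · have h' : ι y + ι z = 0 := by rw [← map_add, h, map_zero]
    have : (E.2 - B.2) * ι y = 0 := by linear_combination (D.2 - B.2) * h' - hyz
    have := (mul_eq_zero.mp this).resolve_right ((map_ne_zero ι).mpr hy0)
    exact hBE (Prod.ext e (sub_eq_zero.mp this).symm)

theorem isGood_templateColoring (hs : IsSign ι sg) : IsGood (templateColoring ι sg) := by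
  have S := templateColoring_symm hs
  have flip : ∀ {A B D : Fin 6 × F}, templateColoring ι sg A B = templateColoring ι sg B D →
      templateColoring ι sg B A = templateColoring ι sg B D := fun h => by rw [S, h]
  have twoStep : ∀ {A B D E : Fin 6 × F}, A ≠ D → B ≠ E →
      templateColoring ι sg A B = templateColoring ι sg B D →
      templateColoring ι sg B D ≠ templateColoring ι sg D E := by
    intro A B D E hAD hBE h h'
    obtain ⟨-, h₁, h₂, h₃, -⟩ := templateColoring_path hs hAD (flip h)
    obtain ⟨-, -, h₄, h₅, -⟩ := templateColoring_path hs hBE (flip h')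
    rw [hs.sub_swap h₁] at h₄ h₅
    exact h₅ (slot_path _ _ _ _ _ h₂ h₃ _ _ h₄)
  refine ⟨S, ?_, ?_, ?_, ?_, ?_, ?_, ?_⟩
  · intro A B D E hAB hAD hAE hBD hBE hDE h h'
    obtain ⟨-, -, h₁, h₂, -⟩ := templateColoring_path hs hBD h
    obtain ⟨-, -, h₃, h₄, -⟩ := templateColoring_path hs hBE h'
    obtain ⟨-, -, -, h₅, -⟩ := templateColoring_path hs hDE (h.symm.trans h')
    rcases slot_star _ _ _ _ _ h₁ h₂ _ _ h₃ with e | e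
    exacts [h₄ e, h₅ e]
  · intro A B D hAB hAD hBD h h'
    exact twoStep hAD hAB.symm h h'
  · intro A B D E hAB hAD hAE hBD hBE hDE h h'
    exact twoStep hAD hBE h h'
  · intro A B D E hAB hAD hAE hBD hBE hDE h h'
    obtain ⟨-, -, h₁, h₂, -⟩ := templateColoring_path hs hAD (flip h)
    obtain ⟨-, -, h₃, h₄, -⟩ := templateColoring_path hs hAD (flip h').symm
    obtain ⟨hne, -, h₅⟩ := templateColoring_closing hs hAD (flip h)
    obtain ⟨-, -, h₆⟩ := templateColoring_closing hs hAD (flip h').symm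
    have e : B.2 = E.2 := h₅.symm.trans h₆
    rw [← e] at h₃
    exact hBE (Prod.ext (slot_center_unique _ _ _ _ _ h₁ h₂ _ h₃) e)
  · intro A B D E hAB hAD hAE hBD hBE hDE h h'
    obtain ⟨-, -, h₁, h₂, -⟩ := templateColoring_path hs hAD (flip h)
    obtain ⟨hne, h₃, -⟩ := templateColoring_closing hs hAD (flip h)
    obtain ⟨-, -, h₄, h₅, -⟩ := templateColoring_path hs hAE h'
    rw [hs.sub_swap hne, h₃] at h₄ h₅
    exact h₅ (slot_closing_single _ _ _ _ _ h₁ h₂ _ _ h₄)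
  · intro A B D E hAB hAD hAE hBD hBE hDE h h'
    obtain ⟨hne, -, h₁⟩ := templateColoring_closing hs hAD (flip h)
    obtain ⟨hBE', -, h₂⟩ := templateColoring_eq_inl hne h'
    rw [h₁, left_eq_add] at h₂
    exact (mul_eq_zero.mp h₂).elim (map_template_ne_zero ι _ _ _)
      (sub_ne_zero.mpr (Ne.symm hBE'))
  · intro A B D E hAB hAD hAE hBD hBE hDE h h'
    by_cases e₁ : A.2 = B.2
    · exact templateColoring_alternating_vertical hs hAB hAD hAE e₁ h h'
    by_cases e₂ : B.2 = D.2
    · exact templateColoring_alternating_vertical hs hBD hBE hAB.symm e₂ h' h.symm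
    exact templateColoring_alternating_cross hs hAD hBE e₁ e₂ h h'

end TemplateColoring

section GaloisFields

theorem residue_neg : ∀ a : ZMod 23, a ≠ 0 → residue a = false → residue (-a) = true := by
  decide +kernel

open Classical in
theorem isSign_of_card {F : Type*} [Field F] [Fintype F] (ι : ZMod 23 →+* F)
    (hcard : Fintype.card F % 4 = 3) : IsSign ι fun x => decide (quadraticChar F x = 1) := by
  have hchar : ringChar F ≠ 2 := fun h => by
    have := FiniteField.even_card_of_char_two h
    omega
  have hne : (-1 : ℤ) ≠ 1 := by norm_num
  have hneg : quadraticChar F (-1) = -1 := by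
    refine (quadraticChar_neg_one_iff_not_isSquare).mpr fun h => ?_
    exact FiniteField.isSquare_neg_one_iff.mp h hcard
  have hneg' : ∀ x : F, x ≠ 0 →
      decide (quadraticChar F (-x) = 1) = !decide (quadraticChar F x = 1) := by
    intro x hx
    rw [neg_eq_neg_one_mul, map_mul, hneg]
    rcases quadraticChar_dichotomy hx with e | e <;> rw [e] <;> decide
  have hsq : ∀ a, a ≠ 0 → residue a = true → decide (quadraticChar F (ι a) = 1) = true := by
    intro a ha h
    have hι : ι a ≠ 0 := (map_ne_zero ι).mpr ha
    rw [decide_eq_true_iff, quadraticChar_one_iff_isSquare hι]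
    exact ((residue_iff_isSquare a ha).mp h).map ι
  refine ⟨fun x y hx hy => ?_, hneg', fun a ha => ?_⟩
  · rw [map_mul]
    rcases quadraticChar_dichotomy hx with e | e <;>
      rcases quadraticChar_dichotomy hy with e' | e' <;> rw [e, e'] <;> decide
  · cases h : residue a with
    | true => exact hsq a ha h
    | false =>
      have h' := hsq (-a) (neg_ne_zero.mpr ha) (residue_neg a ha h)
      rw [map_neg, hneg' _ ((map_ne_zero ι).mpr ha)] at h'
      simpa using h'

theorem erdosGyarfas_le_of_odd {k : ℕ} (hk : Odd k) {r n : ℕ}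
    (hr : ∀ t, 0 < t → t ≤ 32 * (6 * 23 ^ k) → Nat.Coprime t r) (hr0 : r ≠ 0)
    (hn : n ≤ 6 * 23 ^ k * r) : erdosGyarfas n 4 5 ≤ (5 * 23 ^ k + 24) * r := by
  classical
  let F := GaloisField 23 k
  have : Fintype F := Fintype.ofFinite F
  have hk0 : k ≠ 0 := by
    rintro rfl
    simp at hk
  have hF : Fintype.card F = 23 ^ k := by
    rw [← Nat.card_eq_fintype_card]
    exact GaloisField.card 23 k hk0
  have hmod : Fintype.card F % 4 = 3 := by
    obtain ⟨j, rfl⟩ := hk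
    rw [hF, pow_succ, pow_mul, Nat.mul_mod, Nat.pow_mod]
    norm_num
  have hX : Fintype.card (Fin 6 × F) = 6 * 23 ^ k := by simp [hF]
  have hC : Fintype.card ((Fin 5 × F) ⊕ Sym2 (Fin 6)) = 5 * 23 ^ k + 21 := by
    rw [Fintype.card_sum, Fintype.card_prod, Sym2.card, hF, Fintype.card_fin, Fintype.card_fin]
    rfl
  have hgood := isGood_templateColoring (isSign_of_card (algebraMap (ZMod 23) F) hmod)
  have hpos : 0 < 23 ^ k := by positivity
  have := hgood.erdosGyarfas_blowUp_le (r := r) (n := n) (by rw [hX]; omega) (by rwa [hX]) hr0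
    (by rwa [hX])
  rwa [hC] at this

end GaloisFields

theorem erdosGyarfas_four_five_upper_bound :
    ∀ ε : ℝ, 0 < ε → ∃ N : ℕ, ∀ n : ℕ, N ≤ n →
      (erdosGyarfas n 4 5 : ℝ) ≤ (5 / 6 + ε) * (n : ℝ) := by
  intro ε hε
  obtain ⟨j, hj⟩ := exists_nat_gt (8 / ε)
  set q : ℕ := 23 ^ (2 * j + 1) with hq
  have hqj : j < q := calc
    j < 2 * j + 1 := by omega
    _ < 23 ^ (2 * j + 1) := Nat.lt_pow_self (by norm_num)
  have hq0 : 0 < q := by positivity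
  have hqR : (0 : ℝ) < q := by exact_mod_cast hq0
  set P : ℕ := (32 * (6 * q)).factorial with hP
  have hP0 : 0 < P := Nat.factorial_pos _
  obtain ⟨N, hN⟩ := exists_nat_gt ((5 * q + 24) * (P + 1) / (ε / 2) : ℝ)
  refine ⟨N, fun n hn => ?_⟩
  set t : ℕ := n / (6 * q * P) + 1 with ht
  have hcop : ∀ s, 0 < s → s ≤ 32 * (6 * q) → Nat.Coprime s (P * t + 1) := by
    intro s hs hs'
    obtain ⟨u, hu⟩ : s ∣ P * t := (Nat.dvd_factorial hs hs').mul_right t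
    rw [hu]
    simp
  have hMr : n ≤ 6 * q * (P * t + 1) := by
    have := Nat.lt_mul_div_succ n (show 0 < 6 * q * P by positivity)
    calc n ≤ 6 * q * P * t := this.le
      _ ≤ 6 * q * (P * t + 1) := by nlinarith
  have hle := erdosGyarfas_le_of_odd ⟨j, rfl⟩ hcop (Nat.succ_ne_zero _) hMr
  rw [← hq] at hle
  have hr : ((P * t + 1 : ℕ) : ℝ) ≤ n / (6 * q) + (P + 1) := by
    have h1 : ((n / (6 * q * P) : ℕ) : ℝ) ≤ n / (6 * q * P) := by
      have := Nat.cast_div_le (α := ℝ) (m := n) (n := 6 * q * P)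
      exact_mod_cast this
    have hPR : (0 : ℝ) < P := by exact_mod_cast hP0
    have h2 : (P : ℝ) * ((n / (6 * q * P) : ℕ) : ℝ) ≤ n / (6 * q) := by
      calc (P : ℝ) * ((n / (6 * q * P) : ℕ) : ℝ) ≤ P * (n / (6 * q * P)) := by gcongr
        _ = n / (6 * q) := by field_simp
    rw [ht]
    push_cast at h2 ⊢
    linarith
  have h8 : 8 < ε * q := by
    have h : 8 / ε < q := hj.trans (by exact_mod_cast hqj)
    rw [div_lt_iff₀ hε] at h
    linarith
  have hconst : (5 * q + 24) * (P + 1) ≤ ε / 2 * (n : ℝ) := by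
    have h : ((5 * q + 24) * (P + 1) / (ε / 2) : ℝ) < n := hN.trans_le (by exact_mod_cast hn)
    rw [div_lt_iff₀ (by positivity)] at h
    linarith
  have hmain : (5 * q + 24) * ((n : ℝ) / (6 * q)) ≤ (5 / 6 + ε / 2) * n := by
    rw [← mul_div_assoc, div_le_iff₀ (by positivity)]
    have hn0 : (0 : ℝ) ≤ n := Nat.cast_nonneg n
    nlinarith [mul_nonneg hn0 (sub_nonneg.mpr h8.le)]
  calc (erdosGyarfas n 4 5 : ℝ) ≤ ((5 * q + 24) * (P * t + 1) : ℕ) := by exact_mod_cast hle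
    _ = (5 * q + 24) * ((P * t + 1 : ℕ) : ℝ) := by push_cast; ring
    _ ≤ (5 * q + 24) * (n / (6 * q) + (P + 1)) := by gcongr
    _ ≤ (5 / 6 + ε) * n := by linarith
end
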